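/- arXiv:math/0301322 — 2 statements merged into one kernel-verified Lean document; each statement's English description precedes it below -/
import Mathlib

section
/- Let r be a positive integer, let a and b be nonnegative integers, and define the polynomial χ(s) = ∏_{j=1}^r (s+1+(j-1)a/2)_{1+b+(r-j)a} and, for complex s with Re s > -1, F(s) = ∫_{1>λ_1>⋯>λ_r>0} ∏_{j=1}^r (1-λ_j^2)^s λ_j^{2b+1} ∏_{1≤j<k≤r} (λ_j^2-λ_k^2)^a dλ_1 ⋯ dλ_r. Then χ(s)·F(s) is independent of s: for every complex s with Re s > -1, χ(s)·F(s) = χ(0)·F(0), i.e. F(s) = (χ(0)/χ(s))·F(0). -/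
open MeasureTheory Complex
open Filter Topology

/-- The one-variable weight `(1 - t²)^s t^(2b+1)`. -/
noncomputable def jacobiWeight (s : ℂ) (b : ℕ) (t : ℝ) : ℂ :=
  (1 - (t : ℂ) ^ 2) ^ s * ((t ^ (2 * b + 1) : ℝ) : ℂ)

/-- The product `∏_{j<k} |l_j² - l_k²|^a`. -/
noncomputable def absDisc (a : ℕ) {r : ℕ} (l : Fin r → ℝ) : ℝ :=
  ∏ j, ∏ k ∈ Finset.Ioi j, |l j ^ 2 - l k ^ 2| ^ a

/-- Lebesgue measure on the open unit cube. -/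
noncomputable def cubeMeasure (r : ℕ) : Measure (Fin r → ℝ) :=
  Measure.pi fun _ => (volume : Measure ℝ).restrict (Set.Ioo 0 1)

instance (r : ℕ) : IsFiniteMeasure (cubeMeasure r) := by
  unfold cubeMeasure; infer_instance

/-- The integral of `g` over the cube against the product weight. -/
noncomputable def weightedIntegral (s : ℂ) (b : ℕ) {r : ℕ} (g : (Fin r → ℝ) → ℝ) : ℂ :=
  ∫ l, (∏ i, jacobiWeight s b (l i)) * (g l : ℂ) ∂cubeMeasure r

/-- Measurable functions that are bounded on the open unit cube. -/
def BddOnCube {r : ℕ} (g : (Fin r → ℝ) → ℝ) : Prop :=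
  Measurable g ∧ ∃ C, ∀ l : Fin r → ℝ, (∀ i, l i ∈ Set.Ioo (0 : ℝ) 1) → |g l| ≤ C

theorem cubeMeasure_eq (r : ℕ) : cubeMeasure r =
    (volume : Measure (Fin r → ℝ)).restrict (Set.univ.pi fun _ => Set.Ioo 0 1) := by
  rw [cubeMeasure, volume_pi, Measure.restrict_pi_pi]

theorem ae_cubeMeasure (r : ℕ) : ∀ᵐ l ∂cubeMeasure r, ∀ i, l i ∈ Set.Ioo (0 : ℝ) 1 := by
  rw [cubeMeasure_eq]
  filter_upwards [ae_restrict_mem (MeasurableSet.univ_pi fun _ => measurableSet_Ioo)] with l hl i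
  exact hl i trivial

theorem BddOnCube.of_continuous {r : ℕ} {g : (Fin r → ℝ) → ℝ} (hg : Continuous g) :
    BddOnCube g := by
  refine ⟨hg.measurable, ?_⟩
  obtain ⟨C, hC⟩ := (isCompact_univ_pi fun _ : Fin r => isCompact_Icc (a := (0 : ℝ)) (b := 1)
    ).exists_bound_of_continuousOn hg.continuousOn
  exact ⟨C, fun l hl => hC l fun i _ => Set.Ioo_subset_Icc_self (hl i)⟩

theorem BddOnCube.mul {r : ℕ} {f g : (Fin r → ℝ) → ℝ} (hf : BddOnCube f) (hg : BddOnCube g) :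
    BddOnCube fun l => f l * g l := by
  obtain ⟨hf, C, hC⟩ := hf
  obtain ⟨hg, D, hD⟩ := hg
  refine ⟨hf.mul hg, C * D, fun l hl => ?_⟩
  rw [abs_mul]
  exact mul_le_mul (hC l hl) (hD l hl) (abs_nonneg _) ((abs_nonneg _).trans (hC l hl))

theorem measurable_jacobiWeight (s : ℂ) (b : ℕ) : Measurable (jacobiWeight s b) := by
  unfold jacobiWeight
  fun_prop

theorem integrable_jacobiWeight {s : ℂ} (hs : -1 < s.re) (b : ℕ) :
    Integrable (jacobiWeight s b) ((volume : Measure ℝ).restrict (Set.Ioo 0 1)) := by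
  have h1 : IntervalIntegrable (fun t : ℝ => (1 - t) ^ s.re) volume 0 1 := by
    have := (intervalIntegral.intervalIntegrable_rpow' (a := 0) (b := 1) hs).comp_sub_left 1
    simpa using this.symm
  rw [intervalIntegrable_iff_integrableOn_Ioo_of_le zero_le_one] at h1
  refine Integrable.mono' (h1.const_mul (2 ^ |s.re|))
    (measurable_jacobiWeight s b).aestronglyMeasurable ?_
  filter_upwards [ae_restrict_mem measurableSet_Ioo] with t ht
  have hx : 0 < 1 - t := by linarith [ht.2]
  have hy : 0 < 1 - t ^ 2 := by nlinarith [ht.1, ht.2]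
  have e : (1 - (t : ℂ) ^ 2) = ((1 - t ^ 2 : ℝ) : ℂ) := by push_cast; rfl
  rw [jacobiWeight, norm_mul, e, Complex.norm_cpow_eq_rpow_re_of_pos hy, Complex.norm_real]
  have : (1 - t ^ 2) ^ s.re ≤ 2 ^ |s.re| * (1 - t) ^ s.re := by
    have : 1 - t ^ 2 = (1 + t) * (1 - t) := by ring
    rw [this, Real.mul_rpow (by linarith [ht.1]) hx.le]
    gcongr
    calc (1 + t) ^ s.re ≤ (1 + t) ^ |s.re| :=
          Real.rpow_le_rpow_of_exponent_le (by linarith [ht.1]) (le_abs_self _)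
      _ ≤ 2 ^ |s.re| := Real.rpow_le_rpow (by linarith [ht.1]) (by linarith [ht.2]) (abs_nonneg _)
  have h3 : ‖t ^ (2 * b + 1)‖ ≤ 1 := by
    rw [norm_pow, Real.norm_of_nonneg ht.1.le]
    exact pow_le_one₀ ht.1.le ht.2.le
  calc _ ≤ (1 - t ^ 2) ^ s.re * 1 := by gcongr
    _ ≤ _ := by rw [mul_one]; exact this

theorem BddOnCube.integrable {r : ℕ} {g : (Fin r → ℝ) → ℝ} (hg : BddOnCube g) {s : ℂ}
    (hs : -1 < s.re) (b : ℕ) :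
    Integrable (fun l => (∏ i, jacobiWeight s b (l i)) * (g l : ℂ)) (cubeMeasure r) := by
  obtain ⟨hm, C, hC⟩ := hg
  have h1 : Integrable (fun l : Fin r → ℝ => ∏ i, jacobiWeight s b (l i)) (cubeMeasure r) :=
    Integrable.fintype_prod fun _ => integrable_jacobiWeight hs b
  refine h1.mul_bdd (c := C) (by fun_prop) ?_
  filter_upwards [ae_cubeMeasure r] with l hl
  rw [Complex.norm_real]
  exact hC l hl

theorem weightedIntegral_congr {r : ℕ} {f g : (Fin r → ℝ) → ℝ} (h : ∀ l, f l = g l) (s : ℂ)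
    (b : ℕ) : weightedIntegral s b f = weightedIntegral s b g := by
  rw [funext h]

theorem weightedIntegral_add {r : ℕ} {f g : (Fin r → ℝ) → ℝ} (hf : BddOnCube f)
    (hg : BddOnCube g) {s : ℂ} (hs : -1 < s.re) (b : ℕ) :
    weightedIntegral s b (fun l => f l + g l) =
      weightedIntegral s b f + weightedIntegral s b g := by
  unfold weightedIntegral
  rw [← integral_add (hf.integrable hs b) (hg.integrable hs b)]
  congr 1; ext l; push_cast; ring

theorem weightedIntegral_sub {r : ℕ} {f g : (Fin r → ℝ) → ℝ} (hf : BddOnCube f)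
    (hg : BddOnCube g) {s : ℂ} (hs : -1 < s.re) (b : ℕ) :
    weightedIntegral s b (fun l => f l - g l) =
      weightedIntegral s b f - weightedIntegral s b g := by
  unfold weightedIntegral
  rw [← integral_sub (hf.integrable hs b) (hg.integrable hs b)]
  congr 1; ext l; push_cast; ring

theorem weightedIntegral_const_mul {r : ℕ} (c : ℝ) (f : (Fin r → ℝ) → ℝ) (s : ℂ) (b : ℕ) :
    weightedIntegral s b (fun l => c * f l) = c * weightedIntegral s b f := by
  unfold weightedIntegral
  rw [← integral_const_mul]
  congr 1; ext l; push_cast; ring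

theorem measurePreserving_comp_perm {r : ℕ} (σ : Equiv.Perm (Fin r)) :
    MeasurePreserving (MeasurableEquiv.piCongrLeft (fun _ : Fin r => ℝ) σ.symm)
      (cubeMeasure r) (cubeMeasure r) :=
  measurePreserving_piCongrLeft
    (fun _ : Fin r => (volume : Measure ℝ).restrict (Set.Ioo 0 1)) σ.symm

theorem piCongrLeft_symm_eq_comp {r : ℕ} (σ : Equiv.Perm (Fin r)) (l : Fin r → ℝ) :
    MeasurableEquiv.piCongrLeft (fun _ : Fin r => ℝ) σ.symm l = l ∘ σ := by
  ext i
  have := MeasurableEquiv.piCongrLeft_apply_apply (β := fun _ : Fin r => ℝ) σ.symm l (σ i)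
  simpa using this

theorem weightedIntegral_comp_perm {r : ℕ} (σ : Equiv.Perm (Fin r)) (g : (Fin r → ℝ) → ℝ) (s : ℂ)
    (b : ℕ) : weightedIntegral s b (fun l => g (l ∘ σ)) = weightedIntegral s b g := by
  unfold weightedIntegral
  rw [← (measurePreserving_comp_perm σ).integral_comp'
    (fun l => (∏ i, jacobiWeight s b (l i)) * (g l : ℂ))]
  congr 1; ext l
  rw [piCongrLeft_symm_eq_comp]
  congr 1
  exact (Equiv.prod_comp σ fun i => jacobiWeight s b (l i)).symm

theorem absDisc_eq_det {a r : ℕ} (l : Fin r → ℝ) :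
    absDisc a l = |(Matrix.vandermonde fun i => l i ^ 2).det| ^ a := by
  rw [Matrix.det_vandermonde, absDisc, Finset.abs_prod, ← Finset.prod_pow]
  refine Finset.prod_congr rfl fun i _ => ?_
  rw [Finset.abs_prod, ← Finset.prod_pow]
  exact Finset.prod_congr rfl fun j _ => by rw [abs_sub_comm]

theorem absDisc_comp_perm {a r : ℕ} (l : Fin r → ℝ) (σ : Equiv.Perm (Fin r)) :
    absDisc a (l ∘ σ) = absDisc a l := by
  rw [absDisc_eq_det, absDisc_eq_det]
  have : (Matrix.vandermonde fun i => (l ∘ σ) i ^ 2) =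
      (Matrix.vandermonde fun i => l i ^ 2).submatrix σ id := by
    ext i j; simp [Matrix.vandermonde]
  rw [this, Matrix.det_permute, abs_mul]
  rcases Int.units_eq_one_or (Equiv.Perm.sign σ) with h | h <;> simp [h]

theorem continuous_absDisc (a r : ℕ) : Continuous (absDisc a : (Fin r → ℝ) → ℝ) := by
  unfold absDisc; fun_prop

theorem absDisc_succ {a m : ℕ} (l : Fin (m + 1) → ℝ) :
    absDisc a l = (∏ j : Fin m, |l 0 ^ 2 - l j.succ ^ 2| ^ a) * absDisc a (fun j => l j.succ) := by
  simp only [absDisc, Fin.prod_univ_succ (n := m), Fin.prod_Ioi_zero, Fin.prod_Ioi_succ]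

theorem absDisc_nonneg {a r : ℕ} (l : Fin r → ℝ) : 0 ≤ absDisc a l :=
  Finset.prod_nonneg fun _ _ => Finset.prod_nonneg fun _ _ => by positivity

theorem abs_sq_sub_sq_le_one {x y : ℝ} (hx : x ∈ Set.Ioo (0 : ℝ) 1) (hy : y ∈ Set.Ioo (0 : ℝ) 1) :
    |x ^ 2 - y ^ 2| ≤ 1 := by
  obtain ⟨h1, h2⟩ := hx
  obtain ⟨h3, h4⟩ := hy
  rw [abs_le]; constructor <;> nlinarith

theorem absDisc_le_one {a r : ℕ} (l : Fin r → ℝ) (hl : ∀ i, l i ∈ Set.Ioo (0 : ℝ) 1) :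
    absDisc a l ≤ 1 :=
  Finset.prod_le_one (fun _ _ => Finset.prod_nonneg fun _ _ => by positivity) fun i _ =>
    Finset.prod_le_one (fun _ _ => by positivity) fun j _ =>
      pow_le_one₀ (abs_nonneg _) (abs_sq_sub_sq_le_one (hl i) (hl j))

theorem abs_pow_mul_div_le {a : ℕ} {u : ℝ} (hu : |u| ≤ 1) : |u| ^ a * |a / u| ≤ a := by
  rcases eq_or_ne u 0 with rfl | h
  · simp
  · rcases a with _ | a
    · simp
    · rw [abs_div, pow_succ, Nat.abs_cast]
      have h1 : |u| ≠ 0 := abs_ne_zero.2 h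
      rw [mul_assoc, mul_div_cancel₀ _ h1]
      exact mul_le_of_le_one_left (Nat.cast_nonneg _) (pow_le_one₀ (abs_nonneg _) hu)

theorem bddOnCube_absDisc_mul_div (a : ℕ) {m : ℕ} (j : Fin m) :
    BddOnCube fun l : Fin (m + 1) → ℝ => absDisc a l * (a / (l j.succ ^ 2 - l 0 ^ 2)) := by
  refine ⟨(continuous_absDisc a _).measurable.mul (by fun_prop), a, fun l hl => ?_⟩
  rw [abs_mul, abs_of_nonneg (absDisc_nonneg l), absDisc_succ,
    ← Finset.mul_prod_erase _ _ (Finset.mem_univ j), abs_sub_comm]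
  have h1 : ∏ k ∈ Finset.univ.erase j, |l 0 ^ 2 - l k.succ ^ 2| ^ a ≤ 1 :=
    Finset.prod_le_one (fun _ _ => by positivity) fun k _ =>
      pow_le_one₀ (abs_nonneg _) (abs_sq_sub_sq_le_one (hl _) (hl _))
  have h2 := absDisc_le_one (a := a) (fun j : Fin m => l j.succ) fun i => hl _
  have h3 := abs_pow_mul_div_le (a := a) (abs_sq_sub_sq_le_one (hl j.succ) (hl 0))
  have h0 : 0 ≤ ∏ k ∈ Finset.univ.erase j, |l 0 ^ 2 - l k.succ ^ 2| ^ a :=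
    Finset.prod_nonneg fun _ _ => by positivity
  have h4 := absDisc_nonneg (a := a) (fun j : Fin m => l j.succ)
  set A := |l j.succ ^ 2 - l 0 ^ 2| ^ a
  calc _ = (A * |a / (l j.succ ^ 2 - l 0 ^ 2)|) * ((∏ k ∈ Finset.univ.erase j,
          |l 0 ^ 2 - l k.succ ^ 2| ^ a) * absDisc a (fun j => l j.succ)) := by ring
    _ ≤ a * (1 * 1) := by gcongr
    _ = a := by ring

theorem absDisc_mul_div_mul {a m : ℕ} (l : Fin (m + 1) → ℝ) (j : Fin m) :
    absDisc a l * (a / (l j.succ ^ 2 - l 0 ^ 2)) * (l j.succ ^ 2 - l 0 ^ 2) = a * absDisc a l := by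
  rcases eq_or_ne (l j.succ ^ 2 - l 0 ^ 2) 0 with h | h
  · rcases a with _ | a
    · simp
    · rw [absDisc_succ, ← Finset.mul_prod_erase _ _ (Finset.mem_univ j), abs_sub_comm, h]
      simp
  · field_simp

theorem hasDerivAt_finset_prod_of_logDeriv {ι : Type*} (S : Finset ι) {f : ι → ℝ → ℝ} {g : ι → ℝ}
    {t : ℝ} (h : ∀ i ∈ S, HasDerivAt (f i) (f i t * g i) t) :
    HasDerivAt (fun u => ∏ i ∈ S, f i u) ((∏ i ∈ S, f i t) * ∑ i ∈ S, g i) t := by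
  classical
  induction S using Finset.induction_on with
  | empty => simpa using hasDerivAt_const t (1 : ℝ)
  | insert i S hi ih =>
    simp only [Finset.prod_insert hi, Finset.sum_insert hi]
    refine ((h i (Finset.mem_insert_self _ _)).fun_mul
      (ih fun j hj => h j (Finset.mem_insert_of_mem hj))).congr_deriv ?_
    ring

theorem hasDerivAt_abs_sq_sub_sq_pow (a : ℕ) {y t : ℝ} (h : t ^ 2 - y ^ 2 ≠ 0) :
    HasDerivAt (fun u : ℝ => |u ^ 2 - y ^ 2| ^ a)
      (|t ^ 2 - y ^ 2| ^ a * (2 * t * (a / (t ^ 2 - y ^ 2)))) t := by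
  have h1 : HasDerivAt (fun u : ℝ => u ^ 2 - y ^ 2) (2 * t) t := by
    simpa using (hasDerivAt_pow 2 t).sub_const (y ^ 2)
  have h2 := ((hasDerivAt_abs h).comp t h1).pow a
  refine h2.congr_deriv ?_
  rcases a with _ | a
  · simp
  · have h3 : |t ^ 2 - y ^ 2| * (2 * t * (1 / (t ^ 2 - y ^ 2))) =
        (SignType.sign (t ^ 2 - y ^ 2) : ℝ) * (2 * t) := by
      rw [← sign_mul_self (t ^ 2 - y ^ 2)]
      field_simp
    simp only [Function.comp_apply, Nat.add_sub_cancel, ← h3]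
    ring

/-- A primitive used to integrate by parts in one variable. -/
noncomputable def jacobiPrimitive (s : ℂ) (a b : ℕ) {m : ℕ} (y : Fin m → ℝ) (t : ℝ) : ℂ :=
  (1 - (t : ℂ) ^ 2) ^ (s + 1) *
    ((t ^ (2 * b + 2) * ∏ j, |t ^ 2 - y j ^ 2| ^ a : ℝ) : ℂ)

theorem continuous_jacobiPrimitive {s : ℂ} (hs : -1 < s.re) (a b : ℕ) {m : ℕ} (y : Fin m → ℝ) :
    Continuous (jacobiPrimitive s a b y) := by
  have h := (Complex.continuous_ofReal_cpow_const (y := s + 1) (by simp; linarith)).comp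
    (f := fun t : ℝ => 1 - t ^ 2) (by fun_prop)
  unfold jacobiPrimitive
  refine Continuous.mul ?_ (by fun_prop)
  refine h.congr fun t => ?_
  simp

theorem hasDerivAt_jacobiPrimitive (s : ℂ) (a b : ℕ) {m : ℕ} (y : Fin m → ℝ) {t : ℝ}
    (ht : t ∈ Set.Ioo (0 : ℝ) 1) (hy : ∀ j, t ^ 2 - y j ^ 2 ≠ 0) :
    HasDerivAt (jacobiPrimitive s a b y)
      (-2 * (jacobiWeight s b t * ((∏ j, |t ^ 2 - y j ^ 2| ^ a : ℝ) : ℂ) *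
        ((s + 1) * (t : ℂ) ^ 2 - (b + 1) * (1 - (t : ℂ) ^ 2) +
          ∑ j, (1 - (t : ℂ) ^ 2) * (t : ℂ) ^ 2 * (a / ((y j : ℂ) ^ 2 - (t : ℂ) ^ 2))))) t := by
  have hpos : 0 < 1 - t ^ 2 := by nlinarith [ht.1, ht.2]
  have hslit : 1 - (t : ℂ) ^ 2 ∈ slitPlane := by
    have : (1 - (t : ℂ) ^ 2) = ((1 - t ^ 2 : ℝ) : ℂ) := by push_cast; rfl
    rw [this]; exact Complex.ofReal_mem_slitPlane.2 hpos
  have hne : 1 - (t : ℂ) ^ 2 ≠ 0 := slitPlane_ne_zero hslit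
  have h1 : HasDerivAt (fun u : ℂ => (1 - u ^ 2) ^ (s + 1))
      ((s + 1) * (1 - (t : ℂ) ^ 2) ^ s * (-(2 * t))) (t : ℂ) := by
    have h0 : HasDerivAt (fun u : ℂ => 1 - u ^ 2) (-(2 * (t : ℂ))) (t : ℂ) := by
      simpa using (hasDerivAt_pow 2 (t : ℂ)).const_sub 1
    simpa using h0.cpow_const (c := s + 1) hslit
  have h2 := ((hasDerivAt_pow (2 * b + 2) t).fun_mul (hasDerivAt_finset_prod_of_logDeriv Finset.univ
    fun j _ => hasDerivAt_abs_sq_sub_sq_pow a (hy j))).ofReal_comp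
  refine (h1.comp_ofReal.mul h2).congr_deriv ?_
  have h4 : (∑ j, (1 - (t : ℂ) ^ 2) * (t : ℂ) ^ 2 * (a / ((y j : ℂ) ^ 2 - (t : ℂ) ^ 2))) =
      -(1 - (t : ℂ) ^ 2) * (t : ℂ) * 2⁻¹ *
        ∑ j, 2 * (t : ℂ) * (a / ((t : ℂ) ^ 2 - (y j : ℂ) ^ 2)) := by
    rw [Finset.mul_sum]
    refine Finset.sum_congr rfl fun j _ => ?_
    rw [show (y j : ℂ) ^ 2 - (t : ℂ) ^ 2 = -((t : ℂ) ^ 2 - (y j : ℂ) ^ 2) by ring, div_neg]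
    ring
  rw [h4, jacobiWeight]
  rw [Complex.cpow_add _ _ hne, Complex.cpow_one]
  push_cast
  ring

theorem jacobiPrimitive_one {s : ℂ} (hs : -1 < s.re) (a b : ℕ) {m : ℕ} (y : Fin m → ℝ) :
    jacobiPrimitive s a b y 1 = 0 := by
  have : s + 1 ≠ 0 := fun h => by
    have := congrArg Complex.re h
    simp at this; linarith
  simp [jacobiPrimitive, Complex.zero_cpow this]

theorem jacobiPrimitive_zero (s : ℂ) (a b : ℕ) {m : ℕ} (y : Fin m → ℝ) :
    jacobiPrimitive s a b y 0 = 0 := by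
  simp [jacobiPrimitive]

/-- The integrand obtained by differentiating in the first variable. -/
noncomputable def stokesIntegrand (s : ℂ) (a b : ℕ) {m : ℕ} (q : (Fin m → ℝ) → ℝ)
    (l : Fin (m + 1) → ℝ) : ℂ :=
  (s + 1) * ((∏ i, jacobiWeight s b (l i)) *
      ((absDisc a l * q (fun j => l j.succ) * l 0 ^ 2 : ℝ) : ℂ)) -
    (b + 1) * ((∏ i, jacobiWeight s b (l i)) *
      ((absDisc a l * q (fun j => l j.succ) * (1 - l 0 ^ 2) : ℝ) : ℂ)) +
    ∑ j : Fin m, (∏ i, jacobiWeight s b (l i)) *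
      ((absDisc a l * (a / (l j.succ ^ 2 - l 0 ^ 2)) *
        (q (fun j => l j.succ) * ((1 - l 0 ^ 2) * l 0 ^ 2)) : ℝ) : ℂ)

theorem stokesIntegrand_cons (s : ℂ) (a b : ℕ) {m : ℕ} (q : (Fin m → ℝ) → ℝ) (y : Fin m → ℝ)
    {t : ℝ} : stokesIntegrand s a b q (Fin.cons t y : Fin (m + 1) → ℝ) =
      (∏ j, jacobiWeight s b (y j)) * ((absDisc a y * q y : ℝ) : ℂ) *
      (jacobiWeight s b t * ((∏ j, |t ^ 2 - y j ^ 2| ^ a : ℝ) : ℂ) *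
        ((s + 1) * (t : ℂ) ^ 2 - (b + 1) * (1 - (t : ℂ) ^ 2) +
          ∑ j, (1 - (t : ℂ) ^ 2) * (t : ℂ) ^ 2 * (a / ((y j : ℂ) ^ 2 - (t : ℂ) ^ 2)))) := by
  simp only [stokesIntegrand, absDisc_succ, Fin.prod_univ_succ, Fin.cons_zero, Fin.cons_succ,
    mul_add, mul_sub, Finset.mul_sum]
  push_cast
  congr 1
  · ring
  · refine Finset.sum_congr rfl fun j _ => by ring

theorem bddOnCube_terms (a : ℕ) {m : ℕ} {q : (Fin m → ℝ) → ℝ} (hq : Continuous q) :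
    (BddOnCube fun l : Fin (m + 1) → ℝ => absDisc a l * q (fun j => l j.succ) * l 0 ^ 2) ∧
    (BddOnCube fun l : Fin (m + 1) → ℝ => absDisc a l * q (fun j => l j.succ) * (1 - l 0 ^ 2)) ∧
    ∀ j : Fin m, BddOnCube fun l : Fin (m + 1) → ℝ =>
      absDisc a l * (a / (l j.succ ^ 2 - l 0 ^ 2)) *
        (q (fun j => l j.succ) * ((1 - l 0 ^ 2) * l 0 ^ 2)) := by
  have hd := continuous_absDisc a (m + 1)
  exact ⟨.of_continuous (by fun_prop), .of_continuous (by fun_prop), fun j =>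
    (bddOnCube_absDisc_mul_div a j).mul (.of_continuous (by fun_prop))⟩

theorem integrable_stokesIntegrand {s : ℂ} (hs : -1 < s.re) (a b : ℕ) {m : ℕ}
    {q : (Fin m → ℝ) → ℝ} (hq : Continuous q) :
    Integrable (stokesIntegrand s a b q) (cubeMeasure (m + 1)) := by
  obtain ⟨h1, h2, h3⟩ := bddOnCube_terms a hq
  exact (((h1.integrable hs b).const_mul _).sub ((h2.integrable hs b).const_mul _)).add
    (integrable_finsetSum _ fun j _ => (h3 j).integrable hs b)

theorem integral_stokesIntegrand {s : ℂ} (hs : -1 < s.re) (a b : ℕ) {m : ℕ}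
    {q : (Fin m → ℝ) → ℝ} (hq : Continuous q) :
    ∫ l, stokesIntegrand s a b q l ∂cubeMeasure (m + 1) = 0 := by
  have hi := integrable_stokesIntegrand hs a b hq
  have hmp := (measurePreserving_piFinSuccAbove
    (fun _ : Fin (m + 1) => (volume : Measure ℝ).restrict (Set.Ioo 0 1)) 0).symm
  have hcons : ∀ p : ℝ × (Fin m → ℝ),
      (MeasurableEquiv.piFinSuccAbove (fun _ : Fin (m + 1) => ℝ) 0).symm p = Fin.cons p.1 p.2 := by
    intro p
    simp [MeasurableEquiv.piFinSuccAbove, Fin.insertNthEquiv]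
  have hi' : Integrable (fun p : ℝ × (Fin m → ℝ) =>
      stokesIntegrand s a b q (Fin.cons p.1 p.2 : Fin (m + 1) → ℝ))
      (((volume : Measure ℝ).restrict (Set.Ioo 0 1)).prod (cubeMeasure m)) := by
    have := hmp.integrable_comp_of_integrable hi
    exact this.congr (.of_forall fun p => by simp only [Function.comp_apply, hcons])
  have e : ∫ l, stokesIntegrand s a b q l ∂cubeMeasure (m + 1) =
      ∫ p, stokesIntegrand s a b q (Fin.cons p.1 p.2 : Fin (m + 1) → ℝ)
        ∂(((volume : Measure ℝ).restrict (Set.Ioo 0 1)).prod (cubeMeasure m)) := by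
    have := hmp.integral_comp' (stokesIntegrand s a b q)
    rw [cubeMeasure, ← this]
    simp only [hcons]
    rfl
  rw [e, integral_prod_symm _ hi']
  refine integral_eq_zero_of_ae ?_
  filter_upwards [hi'.prod_left_ae, ae_cubeMeasure m] with y hy hmem
  simp only [stokesIntegrand_cons] at hy ⊢
  set c : ℂ := (∏ j, jacobiWeight s b (y j)) * ((absDisc a y * q y : ℝ) : ℂ)
  have key := integral_eq_of_hasDerivAt_off_countable_of_le
    (fun t => -2⁻¹ * c * jacobiPrimitive s a b y t) (fun t => c *
      (jacobiWeight s b t * ((∏ j, |t ^ 2 - y j ^ 2| ^ a : ℝ) : ℂ) *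
        ((s + 1) * (t : ℂ) ^ 2 - (b + 1) * (1 - (t : ℂ) ^ 2) +
          ∑ j, (1 - (t : ℂ) ^ 2) * (t : ℂ) ^ 2 * (a / ((y j : ℂ) ^ 2 - (t : ℂ) ^ 2)))))
    (a := 0) (b := 1) zero_le_one (s := Set.range y) (Set.countable_range y)
    ((continuous_jacobiPrimitive hs a b y).const_mul _).continuousOn
    (fun t ht => by
      have := (hasDerivAt_jacobiPrimitive s a b y ht.1 fun j h => ht.2 ⟨j, by
        have h1 := (hmem j).1
        have h2 := ht.1.1
        nlinarith [mul_self_nonneg (t - y j)]⟩).const_mul (-2⁻¹ * c)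
      refine this.congr_deriv ?_
      ring)
    ((intervalIntegrable_iff_integrableOn_Ioo_of_le zero_le_one).2 hy)
  rw [intervalIntegral.integral_of_le zero_le_one, integral_Ioc_eq_integral_Ioo] at key
  simpa [jacobiPrimitive_one hs, jacobiPrimitive_zero] using key

theorem weightedIntegral_stokes {s : ℂ} (hs : -1 < s.re) (a b : ℕ) {m : ℕ}
    {q : (Fin m → ℝ) → ℝ} (hq : Continuous q) :
    (s + 1) * weightedIntegral s b (fun l : Fin (m + 1) → ℝ =>
        absDisc a l * q (fun j => l j.succ) * l 0 ^ 2) -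
      (b + 1) * weightedIntegral s b (fun l : Fin (m + 1) → ℝ =>
        absDisc a l * q (fun j => l j.succ) * (1 - l 0 ^ 2)) +
      ∑ j : Fin m, weightedIntegral s b (fun l : Fin (m + 1) → ℝ =>
        absDisc a l * (a / (l j.succ ^ 2 - l 0 ^ 2)) *
          (q (fun j => l j.succ) * ((1 - l 0 ^ 2) * l 0 ^ 2))) = 0 := by
  obtain ⟨h1, h2, h3⟩ := bddOnCube_terms a hq
  have i1 := (h1.integrable hs b).const_mul (s + 1)
  have i2 := (h2.integrable hs b).const_mul ((b : ℂ) + 1)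
  have h := integral_add (i1.sub i2)
    (integrable_finsetSum Finset.univ fun j _ => (h3 j).integrable hs b)
  rw [integral_sub' i1 i2, integral_const_mul, integral_const_mul,
    integral_finsetSum _ fun j _ => (h3 j).integrable hs b] at h
  exact h.symm.trans (integral_stokesIntegrand hs a b hq)

theorem BddOnCube.add {r : ℕ} {f g : (Fin r → ℝ) → ℝ} (hf : BddOnCube f) (hg : BddOnCube g) :
    BddOnCube fun l => f l + g l := by
  obtain ⟨hf, C, hC⟩ := hf
  obtain ⟨hg, D, hD⟩ := hg
  exact ⟨hf.add hg, C + D, fun l hl => (abs_add_le _ _).trans (add_le_add (hC l hl) (hD l hl))⟩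

theorem BddOnCube.comp_perm {r : ℕ} {f : (Fin r → ℝ) → ℝ} (hf : BddOnCube f)
    (σ : Equiv.Perm (Fin r)) : BddOnCube fun l => f (l ∘ σ) := by
  obtain ⟨hf, C, hC⟩ := hf
  exact ⟨hf.comp (by unfold Function.comp; fun_prop), C, fun l hl => hC _ fun i => hl _⟩

/-- The integral of `∏_{i ∈ T} (1 - l_i²)` against the full weight. -/
noncomputable def jacobiMoment (s : ℂ) (a b : ℕ) {r : ℕ} (T : Finset (Fin r)) : ℂ :=
  weightedIntegral s b fun l => absDisc a l * ∏ i ∈ T, (1 - l i ^ 2)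

theorem jacobiMoment_map (s : ℂ) (a b : ℕ) {r : ℕ} (T : Finset (Fin r))
    (σ : Equiv.Perm (Fin r)) :
    jacobiMoment s a b (T.map σ.toEmbedding) = jacobiMoment s a b T := by
  unfold jacobiMoment
  rw [← weightedIntegral_comp_perm σ fun l => absDisc a l * ∏ i ∈ T, (1 - l i ^ 2)]
  refine weightedIntegral_congr (fun l => ?_) s b
  rw [absDisc_comp_perm, Finset.prod_map]
  rfl

theorem bddOnCube_moment (a : ℕ) {r : ℕ} (T : Finset (Fin r)) :
    BddOnCube fun l : Fin r → ℝ => absDisc a l * ∏ i ∈ T, (1 - l i ^ 2) := by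
  have hd := continuous_absDisc a r
  exact .of_continuous (by fun_prop)

theorem two_mul_weightedIntegral_of_add_comp_perm {r : ℕ} {f g : (Fin r → ℝ) → ℝ}
    (hf : BddOnCube f) (σ : Equiv.Perm (Fin r)) (h : ∀ l, f l + f (l ∘ σ) = g l) {s : ℂ}
    (hs : -1 < s.re) (b : ℕ) : 2 * weightedIntegral s b f = weightedIntegral s b g := by
  rw [← weightedIntegral_congr h s b, weightedIntegral_add hf (hf.comp_perm σ) hs,
    weightedIntegral_comp_perm]
  ring

theorem bddOnCube_pairing (a : ℕ) {m : ℕ} (S : Finset (Fin m)) (j : Fin m) :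
    BddOnCube fun l : Fin (m + 1) → ℝ => absDisc a l * (a / (l j.succ ^ 2 - l 0 ^ 2)) *
      ((∏ i ∈ S, (1 - l i.succ ^ 2)) * ((1 - l 0 ^ 2) * l 0 ^ 2)) :=
  (bddOnCube_absDisc_mul_div a j).mul (.of_continuous (by fun_prop))

theorem prod_comp_swap_of_notMem {m : ℕ} (S : Finset (Fin m)) (j : Fin m) (hj : j ∉ S)
    (l : Fin (m + 1) → ℝ) :
    ∏ i ∈ S, (1 - (l ∘ Equiv.swap 0 j.succ) i.succ ^ 2) = ∏ i ∈ S, (1 - l i.succ ^ 2) := by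
  refine Finset.prod_congr rfl fun i hi => ?_
  rw [Function.comp_apply, Equiv.swap_apply_of_ne_of_ne (Fin.succ_ne_zero i)
    fun h => hj (by rwa [← Fin.succ_injective _ h])]

theorem two_mul_pairing_of_mem {s : ℂ} (hs : -1 < s.re) (a b : ℕ) {m : ℕ}
    (S : Finset (Fin m)) (j : Fin m) (hj : j ∈ S) :
    2 * weightedIntegral s b (fun l : Fin (m + 1) → ℝ =>
        absDisc a l * (a / (l j.succ ^ 2 - l 0 ^ 2)) *
          ((∏ i ∈ S, (1 - l i.succ ^ 2)) * ((1 - l 0 ^ 2) * l 0 ^ 2))) =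
      -a * jacobiMoment s a b (insert 0 (S.map (Fin.succEmb m))) := by
  have e := weightedIntegral_const_mul (-a : ℝ) (fun l : Fin (m + 1) → ℝ => absDisc a l *
    ∏ i ∈ insert 0 (S.map (Fin.succEmb m)), (1 - l i ^ 2)) s b
  push_cast at e
  rw [jacobiMoment, ← e]
  refine two_mul_weightedIntegral_of_add_comp_perm (bddOnCube_pairing a S j)
    (Equiv.swap 0 j.succ) (fun l => ?_) hs b
  rw [absDisc_comp_perm, Finset.prod_insert (by simp), Finset.prod_map,
    ← Finset.mul_prod_erase _ _ hj, ← Finset.mul_prod_erase S _ hj,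
    prod_comp_swap_of_notMem _ _ (Finset.notMem_erase j S)]
  simp only [Fin.coe_succEmb, ← Finset.mul_prod_erase S _ hj]
  simp only [Function.comp_apply, Equiv.swap_apply_left, Equiv.swap_apply_right]
  have h := absDisc_mul_div_mul (a := a) l j
  rw [show l 0 ^ 2 - l j.succ ^ 2 = -(l j.succ ^ 2 - l 0 ^ 2) by ring, div_neg]
  linear_combination (-(1 - l 0 ^ 2) * (1 - l j.succ ^ 2) *
    ∏ i ∈ S.erase j, (1 - l i.succ ^ 2)) * h

theorem two_mul_pairing_of_notMem {s : ℂ} (hs : -1 < s.re) (a b : ℕ) {m : ℕ}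
    (S : Finset (Fin m)) (j : Fin m) (hj : j ∉ S) :
    2 * weightedIntegral s b (fun l : Fin (m + 1) → ℝ =>
        absDisc a l * (a / (l j.succ ^ 2 - l 0 ^ 2)) *
          ((∏ i ∈ S, (1 - l i.succ ^ 2)) * ((1 - l 0 ^ 2) * l 0 ^ 2))) =
      a * (jacobiMoment s a b (S.map (Fin.succEmb m)) -
        2 * jacobiMoment s a b (insert 0 (S.map (Fin.succEmb m)))) := by
  have hswap : jacobiMoment s a b (insert j.succ (S.map (Fin.succEmb m))) =
      jacobiMoment s a b (insert 0 (S.map (Fin.succEmb m))) := by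
    rw [← jacobiMoment_map s a b (insert 0 (S.map (Fin.succEmb m))) (Equiv.swap 0 j.succ)]
    congr 1
    rw [Finset.map_insert]
    simp only [Equiv.coe_toEmbedding, Equiv.swap_apply_left]
    congr 1
    rw [Finset.map_map, Finset.map_eq_image, Finset.map_eq_image]
    refine Finset.image_congr fun i hi => ?_
    exact (Equiv.swap_apply_of_ne_of_ne (Fin.succ_ne_zero i)
      fun h => hj (by rwa [← Fin.succ_injective _ h])).symm
  have e : (a : ℂ) * (jacobiMoment s a b (S.map (Fin.succEmb m)) -
        2 * jacobiMoment s a b (insert 0 (S.map (Fin.succEmb m)))) =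
      weightedIntegral s b fun l : Fin (m + 1) → ℝ => (a : ℝ) *
        (absDisc a l * ∏ i ∈ S.map (Fin.succEmb m), (1 - l i ^ 2) -
        absDisc a l * ∏ i ∈ insert 0 (S.map (Fin.succEmb m)), (1 - l i ^ 2) -
        absDisc a l * ∏ i ∈ insert j.succ (S.map (Fin.succEmb m)), (1 - l i ^ 2)) := by
    have hd := continuous_absDisc a (m + 1)
    rw [weightedIntegral_const_mul, weightedIntegral_sub (.of_continuous (by fun_prop))
      (bddOnCube_moment _ _) hs, weightedIntegral_sub (bddOnCube_moment _ _)
      (bddOnCube_moment _ _) hs]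
    change _ = _ * (jacobiMoment _ _ _ _ - jacobiMoment _ _ _ _ - jacobiMoment _ _ _ _)
    rw [hswap]
    push_cast
    ring
  rw [e]
  refine two_mul_weightedIntegral_of_add_comp_perm (bddOnCube_pairing a S j)
    (Equiv.swap 0 j.succ) (fun l => ?_) hs b
  rw [absDisc_comp_perm, Finset.prod_insert (by simp), Finset.prod_insert (by simpa using hj),
    Finset.prod_map, prod_comp_swap_of_notMem _ _ hj]
  simp only [Fin.coe_succEmb]
  simp only [Function.comp_apply, Equiv.swap_apply_left, Equiv.swap_apply_right]
  have h := absDisc_mul_div_mul (a := a) l j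
  rw [show l 0 ^ 2 - l j.succ ^ 2 = -(l j.succ ^ 2 - l 0 ^ 2) by ring, div_neg]
  linear_combination ((l 0 ^ 2 + l j.succ ^ 2 - 1) *
    ∏ i ∈ S, (1 - l i.succ ^ 2)) * h

theorem jacobiMoment_insert_zero {s : ℂ} (hs : -1 < s.re) (a b : ℕ) {m : ℕ}
    (S : Finset (Fin m)) :
    (2 * (s + 1) + (m - S.card) * a) * jacobiMoment s a b (S.map (Fin.succEmb m)) =
      (2 * (s + 1) + 2 * (b + 1) + (2 * m - S.card) * a) *
        jacobiMoment s a b (insert 0 (S.map (Fin.succEmb m))) := by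
  have hq : Continuous fun y : Fin m → ℝ => ∏ i ∈ S, (1 - y i ^ 2) := by fun_prop
  have h := weightedIntegral_stokes hs a b hq
  have hd := continuous_absDisc a (m + 1)
  have e0 : weightedIntegral s b (fun l : Fin (m + 1) → ℝ =>
      absDisc a l * (∏ i ∈ S, (1 - l i.succ ^ 2)) * (1 - l 0 ^ 2)) =
      jacobiMoment s a b (insert 0 (S.map (Fin.succEmb m))) := by
    refine weightedIntegral_congr (fun l => ?_) s b
    rw [Finset.prod_insert (by simp), Finset.prod_map]
    simp only [Fin.coe_succEmb]
    ring
  have e1 : weightedIntegral s b (fun l : Fin (m + 1) → ℝ =>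
      absDisc a l * (∏ i ∈ S, (1 - l i.succ ^ 2)) * l 0 ^ 2) =
      jacobiMoment s a b (S.map (Fin.succEmb m)) -
        jacobiMoment s a b (insert 0 (S.map (Fin.succEmb m))) := by
    rw [jacobiMoment, jacobiMoment, ← weightedIntegral_sub (bddOnCube_moment _ _)
      (bddOnCube_moment _ _) hs]
    refine weightedIntegral_congr (fun l => ?_) s b
    rw [Finset.prod_insert (by simp), Finset.prod_map]
    simp only [Fin.coe_succEmb]
    ring
  rw [e0, e1] at h
  set A := jacobiMoment s a b (S.map (Fin.succEmb m))
  set B := jacobiMoment s a b (insert 0 (S.map (Fin.succEmb m)))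
  have h3 : 2 * ∑ j : Fin m, weightedIntegral s b (fun l : Fin (m + 1) → ℝ =>
        absDisc a l * (a / (l j.succ ^ 2 - l 0 ^ 2)) *
          ((∏ i ∈ S, (1 - l i.succ ^ 2)) * ((1 - l 0 ^ 2) * l 0 ^ 2))) =
      S.card * (-a * B) + (m - S.card) * (a * (A - 2 * B)) := by
    rw [Finset.mul_sum, ← Finset.sum_add_sum_compl S,
      Finset.sum_congr rfl fun j hj => two_mul_pairing_of_mem hs a b S j hj,
      Finset.sum_congr rfl fun j hj => two_mul_pairing_of_notMem hs a b S j
        (Finset.mem_compl.1 hj), Finset.sum_const, Finset.sum_const, Finset.card_compl,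
      Fintype.card_fin, nsmul_eq_mul, nsmul_eq_mul, Nat.cast_sub (by simpa using S.card_le_univ)]
  linear_combination 2 * h - h3

theorem jacobiMoment_insert {s : ℂ} (hs : -1 < s.re) (a b : ℕ) {m : ℕ}
    (T : Finset (Fin (m + 1))) {j : Fin (m + 1)} (hj : j ∉ T) :
    (2 * (s + 1) + (m - T.card) * a) * jacobiMoment s a b T =
      (2 * (s + 1) + 2 * (b + 1) + (2 * m - T.card) * a) * jacobiMoment s a b (insert j T) := by
  obtain ⟨S, hS⟩ : ∃ S : Finset (Fin m), S.map (Fin.succEmb m) =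
      T.map (Equiv.swap 0 j).toEmbedding := by
    refine ⟨Finset.univ.filter fun i => i.succ ∈ T.map (Equiv.swap 0 j).toEmbedding, ?_⟩
    ext i
    refine Fin.cases ?_ (fun i => ?_) i
    · simp [hj]
    · simp
  have hcard : S.card = T.card := by
    simpa using congrArg Finset.card hS
  have h := jacobiMoment_insert_zero hs a b S
  have e : insert 0 (T.map (Equiv.swap 0 j).toEmbedding) =
      (insert j T).map (Equiv.swap 0 j).toEmbedding := by
    simp [Finset.map_insert]
  rwa [hS, e, jacobiMoment_map, jacobiMoment_map, hcard] at h

theorem jacobiMoment_mul_prod {s : ℂ} (hs : -1 < s.re) (a b : ℕ) {m : ℕ}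
    (T : Finset (Fin (m + 1))) :
    jacobiMoment s a b T *
        ∏ k ∈ Finset.range T.card, (2 * (s + 1) + 2 * (b + 1) + (2 * m - k) * a : ℂ) =
      jacobiMoment s a b (∅ : Finset (Fin (m + 1))) *
        ∏ k ∈ Finset.range T.card, (2 * (s + 1) + (m - k) * a : ℂ) := by
  induction T using Finset.induction_on with
  | empty => simp
  | insert j T hj ih =>
    rw [Finset.card_insert_of_notMem hj, Finset.prod_range_succ, Finset.prod_range_succ]
    have h := jacobiMoment_insert hs a b T hj
    linear_combination (2 * (s + 1) + (m - T.card) * a) * ih -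
      (∏ k ∈ Finset.range T.card, (2 * (s + 1) + 2 * (b + 1) + (2 * m - k) * a : ℂ)) * h

theorem jacobiWeight_add_one (s : ℂ) (b : ℕ) {t : ℝ} (ht : t ∈ Set.Ioo (0 : ℝ) 1) :
    jacobiWeight (s + 1) b t = jacobiWeight s b t * ((1 - t ^ 2 : ℝ) : ℂ) := by
  have hpos : 0 < 1 - t ^ 2 := by nlinarith [ht.1, ht.2]
  have e : (1 - (t : ℂ) ^ 2) = ((1 - t ^ 2 : ℝ) : ℂ) := by push_cast; rfl
  rw [jacobiWeight, jacobiWeight, e, Complex.cpow_add _ _ (by exact_mod_cast hpos.ne'),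
    Complex.cpow_one]
  ring

theorem jacobiMoment_univ (s : ℂ) (a b r : ℕ) :
    jacobiMoment s a b (Finset.univ : Finset (Fin r)) =
      jacobiMoment (s + 1) a b (∅ : Finset (Fin r)) := by
  unfold jacobiMoment weightedIntegral
  refine integral_congr_ae ?_
  filter_upwards [ae_cubeMeasure r] with l hl
  rw [Finset.prod_congr rfl fun i _ => jacobiWeight_add_one s b (hl i), Finset.prod_mul_distrib]
  push_cast
  simp
  ring

/-- The open simplex `1 > l_0 > ⋯ > l_{r-1} > 0`. -/
def descSimplex (r : ℕ) : Set (Fin r → ℝ) :=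
  {lam : Fin r → ℝ | (∀ j k : Fin r, j < k → lam k < lam j) ∧ (∀ j, 0 < lam j) ∧ (∀ j, lam j < 1)}

theorem measurableSet_descSimplex (r : ℕ) : MeasurableSet (descSimplex r) := by
  unfold descSimplex
  measurability

theorem ae_injective (r : ℕ) : ∀ᵐ l : Fin r → ℝ, Function.Injective l := by
  have h : ∀ i j : Fin r, i ≠ j → ∀ᵐ l : Fin r → ℝ, l i ≠ l j := by
    intro i j hij
    let p : Submodule ℝ (Fin r → ℝ) :=
      LinearMap.ker ((LinearMap.proj i : (Fin r → ℝ) →ₗ[ℝ] ℝ) - LinearMap.proj j)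
    have hp : p ≠ ⊤ := fun h => by
      have : Pi.single i (1 : ℝ) ∈ p := h ▸ Submodule.mem_top
      simp [p, hij.symm] at this
    have := Measure.addHaar_submodule volume p hp
    refine (measure_eq_zero_iff_ae_notMem.1 this).mono fun l hl e => hl ?_
    simp [p, e]
  have h' : ∀ᵐ l : Fin r → ℝ, ∀ i j : Fin r, i ≠ j → l i ≠ l j :=
    ae_all_iff.2 fun i => ae_all_iff.2 fun j => ae_all_iff.2 (h i j)
  filter_upwards [h'] with l hl i j e
  by_contra hij
  exact hl i j hij e

theorem exists_perm_comp_mem_descSimplex {r : ℕ} {l : Fin r → ℝ} (hinj : Function.Injective l)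
    (hl : ∀ i, l i ∈ Set.Ioo (0 : ℝ) 1) : ∃ σ : Equiv.Perm (Fin r), l ∘ σ ∈ descSimplex r := by
  refine ⟨Fin.revPerm.trans (Tuple.sort l), fun j k hjk => ?_, fun j => (hl _).1, fun j => (hl _).2⟩
  have hm : StrictMono (l ∘ Tuple.sort l) :=
    (Tuple.monotone_sort l).strictMono_of_injective (hinj.comp (Tuple.sort l).injective)
  exact hm (Fin.rev_lt_rev.2 hjk)

theorem perm_eq_of_comp_mem_descSimplex {r : ℕ} {l : Fin r → ℝ} {σ τ : Equiv.Perm (Fin r)}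
    (hσ : l ∘ σ ∈ descSimplex r) (hτ : l ∘ τ ∈ descSimplex r) : σ = τ := by
  have hs : StrictAnti (l ∘ σ) := fun j k h => hσ.1 j k h
  have ht : StrictAnti (l ∘ τ) := fun j k h => hτ.1 j k h
  have e : (-l) ∘ σ = (-l) ∘ τ :=
    Tuple.unique_monotone (fun j k h => neg_le_neg (hs.antitone h))
      (fun j k h => neg_le_neg (ht.antitone h))
  have hinj : Function.Injective l := by
    have := hs.injective.comp σ.symm.injective
    simpa [Function.comp_assoc] using this
  ext i
  have := congrFun e i
  simp only [Function.comp_apply, Pi.neg_apply, neg_inj] at this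
  rw [hinj this]

theorem iUnion_preimage_descSimplex_ae_eq (r : ℕ) :
    (⋃ σ : Equiv.Perm (Fin r), (fun l : Fin r → ℝ => l ∘ σ) ⁻¹' descSimplex r) =ᵐ[volume]
      (Set.univ.pi fun _ : Fin r => Set.Ioo (0 : ℝ) 1) := by
  filter_upwards [ae_injective r] with l hinj
  refine propext ⟨fun h i _ => ?_, fun h => ?_⟩
  · obtain ⟨σ, hσ⟩ := Set.mem_iUnion.1 h
    have h1 := hσ.2.1 (σ.symm i)
    have h2 := hσ.2.2 (σ.symm i)
    simp only [Function.comp_apply, Equiv.apply_symm_apply] at h1 h2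
    exact ⟨h1, h2⟩
  · obtain ⟨σ, hσ⟩ := exists_perm_comp_mem_descSimplex hinj fun i => h i trivial
    exact Set.mem_iUnion.2 ⟨σ, hσ⟩

theorem integral_cubeMeasure_eq_factorial_mul {r : ℕ} {g : (Fin r → ℝ) → ℂ}
    (hg : Integrable g (cubeMeasure r)) (hsymm : ∀ (σ : Equiv.Perm (Fin r)) l, g (l ∘ σ) = g l) :
    ∫ l, g l ∂cubeMeasure r = (r.factorial : ℂ) * ∫ l in descSimplex r, g l := by
  rw [cubeMeasure_eq] at hg ⊢
  have hae := iUnion_preimage_descSimplex_ae_eq r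
  rw [← setIntegral_congr_set hae]
  have hg' : IntegrableOn g (⋃ σ : Equiv.Perm (Fin r),
      (fun l : Fin r → ℝ => l ∘ σ) ⁻¹' descSimplex r) := IntegrableOn.congr_set_ae hg hae
  have hmeas : ∀ σ : Equiv.Perm (Fin r), Measurable fun l : Fin r → ℝ => l ∘ σ := fun σ => by
    unfold Function.comp; fun_prop
  rw [integral_iUnion_fintype (fun σ => hmeas σ (measurableSet_descSimplex r))
    (fun σ τ hne => Set.disjoint_left.2 fun l h1 h2 =>
      hne (perm_eq_of_comp_mem_descSimplex h1 h2))
    (fun σ => hg'.mono_set (Set.subset_iUnion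
      (fun σ : Equiv.Perm (Fin r) => (fun l : Fin r → ℝ => l ∘ σ) ⁻¹' descSimplex r) σ))]
  have h1 : ∀ σ : Equiv.Perm (Fin r),
      ∫ l in (fun l : Fin r → ℝ => l ∘ σ) ⁻¹' descSimplex r, g l = ∫ l in descSimplex r, g l := by
    intro σ
    have hmp := volume_measurePreserving_piCongrLeft (fun _ : Fin r => ℝ) σ.symm
    have := hmp.setIntegral_preimage_emb (MeasurableEquiv.measurableEmbedding _) g (descSimplex r)
    rw [← this]
    have e : ⇑(MeasurableEquiv.piCongrLeft (fun _ : Fin r => ℝ) σ.symm) = fun l => l ∘ σ :=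
      funext (piCongrLeft_symm_eq_comp σ)
    simp only [e, hsymm]
  rw [Finset.sum_congr rfl fun σ _ => h1 σ, Finset.sum_const, Finset.card_univ,
    Fintype.card_perm, Fintype.card_fin, nsmul_eq_mul]

theorem jacobiMoment_empty_eq_factorial_mul {s : ℂ} (hs : -1 < s.re) (a b r : ℕ) :
    jacobiMoment s a b (∅ : Finset (Fin r)) = (r.factorial : ℂ) *
      ∫ lam : Fin r → ℝ in
        {lam : Fin r → ℝ | (∀ j k : Fin r, j < k → lam k < lam j) ∧
          (∀ j, 0 < lam j) ∧ (∀ j, lam j < 1)},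
        (∏ j : Fin r,
            ((1 - ((lam j : ℂ)) ^ 2) ^ s * ((lam j ^ (2 * b + 1) : ℝ) : ℂ))) *
          ∏ j : Fin r, ∏ l ∈ Finset.Ioi j, (((lam j ^ 2 - lam l ^ 2) ^ a : ℝ) : ℂ) := by
  unfold jacobiMoment weightedIntegral
  rw [integral_cubeMeasure_eq_factorial_mul ((bddOnCube_moment a ∅).integrable hs b)]
  · congr 1
    refine setIntegral_congr_fun (measurableSet_descSimplex r) fun l hl => ?_
    simp only [Finset.prod_empty, mul_one, absDisc, jacobiWeight, Complex.ofReal_prod]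
    congr 1
    refine Finset.prod_congr rfl fun j _ => Finset.prod_congr rfl fun k hk => ?_
    have h1 := hl.1 j k (Finset.mem_Ioi.1 hk)
    have h2 := hl.2.1 k
    rw [abs_of_pos (by nlinarith)]
  · intro σ l
    rw [absDisc_comp_perm, Finset.prod_empty, Finset.prod_empty]
    congr 1
    exact Equiv.prod_comp σ fun i => jacobiWeight s b (l i)

theorem ascPochhammer_eval_add_one_mul (n : ℕ) (z : ℂ) :
    (ascPochhammer ℂ n).eval (z + 1) * z = (ascPochhammer ℂ n).eval z * (z + n) := by
  rw [← ascPochhammer_succ_eval, ascPochhammer_succ_left]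
  simp [mul_comm]

theorem ascPochhammer_eval_ne_zero (n : ℕ) {z : ℂ} (hz : 0 < z.re) :
    (ascPochhammer ℂ n).eval z ≠ 0 := by
  induction n with
  | zero => simp
  | succ n ih =>
    rw [ascPochhammer_succ_eval]
    refine mul_ne_zero ih fun h => ?_
    have := congrArg Complex.re h
    simp at this
    linarith [(Nat.cast_nonneg n : (0 : ℝ) ≤ n)]

theorem tendsto_natCast_add_div_natCast_add (c d : ℂ) :
    Tendsto (fun n : ℕ => ((n : ℂ) + c) / (n + d)) atTop (𝓝 1) := by
  have h := (tendsto_natCast_div_add_atTop d).div (tendsto_natCast_div_add_atTop c) one_ne_zero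
  rw [div_one] at h
  refine h.congr' ?_
  filter_upwards [eventually_gt_atTop 0] with n hn
  have hn' : (n : ℂ) ≠ 0 := by exact_mod_cast hn.ne'
  simp only [Pi.div_apply]
  rw [div_div_div_cancel_left' _ _ hn']

theorem tendsto_ascPochhammer_ratio (k : ℕ) (c d : ℂ) :
    Tendsto (fun n : ℕ => (ascPochhammer ℂ k).eval ((n : ℂ) + c) /
      (ascPochhammer ℂ k).eval ((n : ℂ) + d)) atTop (𝓝 1) := by
  induction k with
  | zero => simp
  | succ k ih =>
    have h := ih.mul (tendsto_natCast_add_div_natCast_add (c + k) (d + k))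
    rw [mul_one] at h
    refine h.congr fun n => ?_
    rw [ascPochhammer_succ_eval, ascPochhammer_succ_eval, div_mul_div_comm, add_assoc, add_assoc]

/-- The polynomial `χ(s) = ∏_j (s + 1 + j a/2)_{1 + b + (r - 1 - j) a}`. -/
noncomputable def hypergeomChi (r a b : ℕ) (s : ℂ) : ℂ :=
  ∏ j : Fin r, (ascPochhammer ℂ (1 + b + (r - 1 - (j : ℕ)) * a)).eval
    (s + 1 + (j : ℂ) * ((a : ℂ) / 2))

theorem hypergeomChi_arg_re_pos (a j : ℕ) {s : ℂ} (hs : -1 < s.re) :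
    0 < (s + 1 + (j : ℂ) * ((a : ℂ) / 2)).re := by
  have e : (s + 1 + (j : ℂ) * ((a : ℂ) / 2)) = s + ((1 + j * (a / 2) : ℝ) : ℂ) := by
    push_cast; ring
  rw [e, Complex.add_re, Complex.ofReal_re]
  have : (0 : ℝ) ≤ j * (a / 2) := by positivity
  linarith

theorem hypergeomChi_ne_zero (r a b : ℕ) {s : ℂ} (hs : -1 < s.re) : hypergeomChi r a b s ≠ 0 :=
  Finset.prod_ne_zero_iff.2 fun j _ =>
    ascPochhammer_eval_ne_zero _ (hypergeomChi_arg_re_pos a j hs)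

theorem tendsto_hypergeomChi_ratio (r a b : ℕ) (c d : ℂ) :
    Tendsto (fun n : ℕ => hypergeomChi r a b (n + c) / hypergeomChi r a b (n + d)) atTop
      (𝓝 1) := by
  have h := tendsto_finsetProd (Finset.univ : Finset (Fin r)) fun j _ =>
    tendsto_ascPochhammer_ratio (1 + b + (r - 1 - (j : ℕ)) * a)
      (c + 1 + (j : ℂ) * ((a : ℂ) / 2)) (d + 1 + (j : ℂ) * ((a : ℂ) / 2))
  rw [Finset.prod_const_one] at h
  refine h.congr fun n => ?_
  rw [hypergeomChi, hypergeomChi, ← Finset.prod_div_distrib]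
  simp only [add_assoc]

theorem hypergeomChi_add_one_mul (m a b : ℕ) (s : ℂ) :
    hypergeomChi (m + 1) a b (s + 1) *
        ∏ k ∈ Finset.range (m + 1), (2 * (s + 1) + (m - k) * a : ℂ) =
      hypergeomChi (m + 1) a b s *
        ∏ k ∈ Finset.range (m + 1), (2 * (s + 1) + 2 * (b + 1) + (2 * m - k) * a : ℂ) := by
  rw [← Finset.prod_range_reflect, Finset.prod_range, Finset.prod_range, hypergeomChi,
    hypergeomChi, ← Finset.prod_mul_distrib, ← Finset.prod_mul_distrib]
  refine Finset.prod_congr rfl fun j _ => ?_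
  have hj : (j : ℕ) ≤ m := Nat.lt_succ_iff.1 j.2
  have h := ascPochhammer_eval_add_one_mul (1 + b + (m + 1 - 1 - (j : ℕ)) * a)
    (s + 1 + (j : ℂ) * ((a : ℂ) / 2))
  rw [show s + 1 + 1 + (j : ℂ) * ((a : ℂ) / 2) = s + 1 + (j : ℂ) * ((a : ℂ) / 2) + 1 by ring]
  simp only [Nat.add_sub_cancel] at h ⊢
  push_cast [Nat.cast_sub hj] at h ⊢
  linear_combination 2 * h

theorem hypergeomChi_mul_jacobiMoment_add_one {s : ℂ} (hs : -1 < s.re) (m a b : ℕ) :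
    hypergeomChi (m + 1) a b (s + 1) * jacobiMoment (s + 1) a b (∅ : Finset (Fin (m + 1))) =
      hypergeomChi (m + 1) a b s * jacobiMoment s a b (∅ : Finset (Fin (m + 1))) := by
  have h1 := jacobiMoment_mul_prod hs a b (Finset.univ : Finset (Fin (m + 1)))
  rw [jacobiMoment_univ, Finset.card_univ, Fintype.card_fin] at h1
  have h2 := hypergeomChi_add_one_mul m a b s
  have hne :
      ∏ k ∈ Finset.range (m + 1), (2 * (s + 1) + 2 * (b + 1) + (2 * m - k) * a : ℂ) ≠ 0 := by
    refine Finset.prod_ne_zero_iff.2 fun k hk h => ?_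
    have hk' : (k : ℝ) ≤ m := by exact_mod_cast Nat.lt_succ_iff.1 (Finset.mem_range.1 hk)
    have e : (2 * (s + 1) + 2 * (b + 1) + (2 * m - k) * a : ℂ) =
        2 * s + ((2 + 2 * (b + 1) + (2 * m - k) * a : ℝ) : ℂ) := by
      push_cast; ring
    have h3 := congrArg Complex.re h
    rw [e, Complex.add_re, Complex.ofReal_re] at h3
    simp at h3
    have : (0 : ℝ) ≤ (2 * m - k) * a := mul_nonneg (by linarith [(Nat.cast_nonneg m : (0:ℝ) ≤ m)])
      (Nat.cast_nonneg a)
    linarith [(Nat.cast_nonneg b : (0:ℝ) ≤ b)]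
  refine mul_right_cancel₀ hne ?_
  linear_combination hypergeomChi (m + 1) a b (s + 1) * h1 +
    jacobiMoment s a b (∅ : Finset (Fin (m + 1))) * h2

theorem hypergeomChi_mul_jacobiMoment_add_natCast {s : ℂ} (hs : -1 < s.re) (m a b n : ℕ) :
    hypergeomChi (m + 1) a b (n + s) * jacobiMoment (n + s) a b (∅ : Finset (Fin (m + 1))) =
      hypergeomChi (m + 1) a b s * jacobiMoment s a b (∅ : Finset (Fin (m + 1))) := by
  induction n with
  | zero => simp
  | succ n ih =>
    rw [← ih, ← hypergeomChi_mul_jacobiMoment_add_one (s := n + s)]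
    · push_cast
      rw [show (n : ℂ) + 1 + s = n + s + 1 by ring]
    · rw [Complex.add_re, Complex.natCast_re]
      linarith [(Nat.cast_nonneg n : (0:ℝ) ≤ n)]

theorem norm_cpow_sub_one_le {s : ℂ} (hs : 1 ≤ s.re) {t : ℝ} (ht : 0 < t) (ht1 : t ≤ 1) :
    ‖(t : ℂ) ^ s - 1‖ ≤ ‖s‖ * (1 - t) := by
  have hs0 : s ≠ 0 := fun h => by simp [h] at hs; linarith
  have h := (convex_Icc t 1).norm_image_sub_le_of_norm_hasDerivWithin_le
    (f := fun u : ℝ => (u : ℂ) ^ s) (f' := fun u : ℝ => s * (u : ℂ) ^ (s - 1)) (C := ‖s‖)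
    (fun u hu => (hasDerivAt_ofReal_cpow_const (ht.trans_le hu.1).ne' hs0).hasDerivWithinAt)
    (fun u hu => by
      have hu0 := ht.trans_le hu.1
      rw [norm_mul, Complex.norm_cpow_eq_rpow_re_of_pos hu0]
      exact mul_le_of_le_one_right (norm_nonneg _)
        (Real.rpow_le_one hu0.le hu.2 (by simpa using hs)))
    (x := 1) (y := t) ⟨ht1, le_rfl⟩ ⟨le_rfl, ht1⟩
  simpa [Real.norm_eq_abs, abs_sub_comm t 1, abs_of_nonneg (sub_nonneg.2 ht1)] using h

theorem prod_jacobiWeight (s : ℂ) (b : ℕ) {r : ℕ} {l : Fin r → ℝ}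
    (hl : ∀ i, l i ∈ Set.Ioo (0 : ℝ) 1) :
    ∏ i, jacobiWeight s b (l i) =
      ((∏ i, (1 - l i ^ 2) : ℝ) : ℂ) ^ s * ((∏ i, l i ^ (2 * b + 1) : ℝ) : ℂ) := by
  have h : ∀ T : Finset (Fin r), ∏ i ∈ T, (1 - (l i : ℂ) ^ 2) ^ s =
      ((∏ i ∈ T, (1 - l i ^ 2) : ℝ) : ℂ) ^ s := by
    intro T
    induction T using Finset.induction_on with
    | empty => simp
    | insert j T hj ih =>
      have hpos : ∀ i, 0 ≤ 1 - l i ^ 2 := fun i => by nlinarith [(hl i).1, (hl i).2]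
      rw [Finset.prod_insert hj, Finset.prod_insert hj, ih, Complex.ofReal_mul,
        Complex.mul_cpow_ofReal_nonneg (hpos j) (Finset.prod_nonneg fun i _ => hpos i)]
      push_cast
      rfl
  simp only [jacobiWeight]
  rw [Finset.prod_mul_distrib, h, ← Complex.ofReal_prod]

theorem norm_jacobiMoment_sub_le {s : ℂ} (hs : 1 ≤ s.re) (a b r n : ℕ) :
    ‖jacobiMoment (n + s) a b (∅ : Finset (Fin r)) - jacobiMoment n a b (∅ : Finset (Fin r))‖ ≤
      ‖s‖ * ‖jacobiMoment n a b (∅ : Finset (Fin r)) -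
        jacobiMoment (n + 1) a b (∅ : Finset (Fin r))‖ := by
  have hn : (0 : ℝ) ≤ n := Nat.cast_nonneg n
  have hi : ∀ z : ℂ, -1 < z.re → _ := fun z hz =>
    (bddOnCube_moment a (∅ : Finset (Fin r))).integrable hz b
  have i0 := hi n (by simp; linarith)
  have i1 := hi (n + 1) (by simp; linarith)
  have i2 := hi (n + s) (by simp; linarith)
  let t : (Fin r → ℝ) → ℝ := fun l => ∏ i, (1 - l i ^ 2)
  let R : (Fin r → ℝ) → ℝ := fun l => (∏ i, l i ^ (2 * b + 1)) * absDisc a l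
  have ht : ∀ l : Fin r → ℝ, (∀ i, l i ∈ Set.Ioo (0 : ℝ) 1) → 0 < t l ∧ t l ≤ 1 := fun l hl =>
    ⟨Finset.prod_pos fun i _ => by nlinarith [(hl i).1, (hl i).2],
      Finset.prod_le_one (fun i _ => by nlinarith [(hl i).1, (hl i).2])
        fun i _ => by nlinarith [(hl i).1, (hl i).2]⟩
  have hR : ∀ l : Fin r → ℝ, (∀ i, l i ∈ Set.Ioo (0 : ℝ) 1) → 0 ≤ R l := fun l hl =>
    mul_nonneg (Finset.prod_nonneg fun i _ => pow_nonneg (hl i).1.le _) (absDisc_nonneg l)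
  have hP : ∀ (z : ℂ) (l : Fin r → ℝ), (∀ i, l i ∈ Set.Ioo (0 : ℝ) 1) →
      (∏ i, jacobiWeight (n + z) b (l i)) *
        ((absDisc a l * ∏ i ∈ (∅ : Finset (Fin r)), (1 - l i ^ 2) : ℝ) : ℂ) =
      (t l : ℂ) ^ z * ((t l ^ n * R l : ℝ) : ℂ) := by
    intro z l hl
    have h0 : ((t l : ℝ) : ℂ) ≠ 0 := by exact_mod_cast (ht l hl).1.ne'
    rw [prod_jacobiWeight _ b hl]
    change (t l : ℂ) ^ (n + z) * _ * _ = _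
    rw [Complex.cpow_add _ _ h0, Complex.cpow_natCast]
    simp only [R, Finset.prod_empty, mul_one]
    push_cast
    ring
  have hd : jacobiMoment n a b (∅ : Finset (Fin r)) - jacobiMoment (n + 1) a b
      (∅ : Finset (Fin r)) =
      ((∫ l, (1 - t l) * (t l ^ n * R l) ∂cubeMeasure r : ℝ) : ℂ) := by
    rw [jacobiMoment, jacobiMoment, weightedIntegral, weightedIntegral, ← integral_sub i0 i1,
      ← integral_complex_ofReal]
    refine integral_congr_ae ?_
    filter_upwards [ae_cubeMeasure r] with l hl
    have h0 := hP 0 l hl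
    rw [add_zero] at h0
    rw [h0, hP 1 l hl]
    push_cast
    simp
    ring
  have hnn : 0 ≤ᵐ[cubeMeasure r] fun l => (1 - t l) * (t l ^ n * R l) := by
    filter_upwards [ae_cubeMeasure r] with l hl
    exact mul_nonneg (sub_nonneg.2 (ht l hl).2) (mul_nonneg (pow_nonneg (ht l hl).1.le _) (hR l hl))
  rw [hd, Complex.norm_real, Real.norm_of_nonneg (integral_nonneg_of_ae hnn), ← integral_const_mul,
    jacobiMoment, jacobiMoment, weightedIntegral, weightedIntegral, ← integral_sub i2 i0]
  refine norm_integral_le_of_norm_le ?_ ?_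
  · refine Integrable.const_mul ?_ _
    refine ((i0.sub i1).norm).congr ?_
    filter_upwards [ae_cubeMeasure r, hnn] with l hl hl'
    have h0 := hP 0 l hl
    rw [add_zero] at h0
    simp only [Pi.sub_apply]
    rw [h0, hP 1 l hl, Complex.cpow_zero, Complex.cpow_one, ← sub_mul, ← Complex.ofReal_one,
      ← Complex.ofReal_sub, ← Complex.ofReal_mul, Complex.norm_real]
    exact Real.norm_of_nonneg hl'
  · filter_upwards [ae_cubeMeasure r] with l hl
    have h0 := hP 0 l hl
    rw [add_zero] at h0
    have h1 : 0 ≤ t l ^ n * R l := mul_nonneg (pow_nonneg (ht l hl).1.le _) (hR l hl)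
    rw [h0, hP s l hl, Complex.cpow_zero, ← sub_mul, norm_mul, Complex.norm_real,
      Real.norm_of_nonneg h1, ← mul_assoc ‖s‖]
    exact mul_le_mul_of_nonneg_right (norm_cpow_sub_one_le hs (ht l hl).1 (ht l hl).2) h1

theorem hypergeomChi_mul_jacobiMoment_of_one_le {s : ℂ} (hs : 1 ≤ s.re) (m a b : ℕ) :
    hypergeomChi (m + 1) a b s * jacobiMoment s a b (∅ : Finset (Fin (m + 1))) =
      hypergeomChi (m + 1) a b 0 * jacobiMoment 0 a b (∅ : Finset (Fin (m + 1))) := by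
  set χ := hypergeomChi (m + 1) a b
  set M : ℂ → ℂ := fun z => jacobiMoment z a b (∅ : Finset (Fin (m + 1)))
  change χ s * M s = χ 0 * M 0
  have hper : ∀ (z : ℂ), -1 < z.re → ∀ n : ℕ, χ (n + z) * M (n + z) = χ z * M z := fun z hz n =>
    hypergeomChi_mul_jacobiMoment_add_natCast hz m a b n
  have hne : ∀ (z : ℂ), -1 < z.re → ∀ n : ℕ, χ (n + z) ≠ 0 := fun z hz n =>
    hypergeomChi_ne_zero _ _ _ (by
      rw [Complex.add_re, Complex.natCast_re]
      linarith [(Nat.cast_nonneg n : (0:ℝ) ≤ n)])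
  have hlim : ∀ z : ℂ, -1 < z.re →
      Tendsto (fun n : ℕ => χ n * M (n + z)) atTop (𝓝 (χ z * M z)) := by
    intro z hz
    have h := (tendsto_hypergeomChi_ratio (m + 1) a b 0 z).mul_const (χ z * M z)
    rw [one_mul] at h
    refine h.congr fun n => ?_
    change χ (n + 0) / χ (n + z) * _ = _
    rw [← hper z hz n, add_zero]
    have := hne z hz n
    field_simp
  have h0 := hlim 0 (by simp)
  have h1 := hlim 1 (by simp)
  have hs' := hlim s (by linarith)
  have hK : χ 1 * M 1 = χ 0 * M 0 := by
    have := hper 0 (by simp) 1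
    simpa using this
  simp only [add_zero] at h0
  rw [hK] at h1
  have hb : Tendsto (fun n : ℕ => χ n * M (n + s) - χ n * M n) atTop (𝓝 0) := by
    have h2 := ((h0.sub h1).norm).const_mul ‖s‖
    rw [sub_self, norm_zero, mul_zero] at h2
    refine squeeze_zero_norm (fun n => ?_) h2
    rw [← mul_sub, ← mul_sub, norm_mul, norm_mul, mul_left_comm]
    exact mul_le_mul_of_nonneg_left (norm_jacobiMoment_sub_le hs a b (m + 1) n) (norm_nonneg _)
  exact sub_eq_zero.1 (tendsto_nhds_unique (hs'.sub h0) hb)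

theorem hypergeomChi_mul_jacobiMoment {s : ℂ} (hs : -1 < s.re) (m a b : ℕ) :
    hypergeomChi (m + 1) a b s * jacobiMoment s a b (∅ : Finset (Fin (m + 1))) =
      hypergeomChi (m + 1) a b 0 * jacobiMoment 0 a b (∅ : Finset (Fin (m + 1))) := by
  rw [← hypergeomChi_mul_jacobiMoment_add_natCast hs m a b 2]
  refine hypergeomChi_mul_jacobiMoment_of_one_le ?_ m a b
  rw [Complex.add_re, Complex.natCast_re]
  push_cast
  linarith

/-- With `χ(s) = ∏_{j=1}^r (s+1+(j-1)a/2)_{1+b+(r-j)a}` and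
`F(s) = ∫_{1>λ₁>⋯>λ_r>0} ∏ (1-λ_j²)^s λ_j^{2b+1} ∏_{j<k} (λ_j²-λ_k²)^a dλ`,
the product `χ(s)·F(s)` is independent of `s` on `Re s > -1`:
`χ(s)·F(s) = χ(0)·F(0)`.  Here the index `j : Fin r` corresponds to `j+1`
in the classical notation. -/
theorem chi_mul_F_const (r a b : ℕ) (hr : 0 < r)
    (F chi : ℂ → ℂ)
    (hF : ∀ s : ℂ, F s =
      ∫ lam : Fin r → ℝ in
        {lam : Fin r → ℝ | (∀ j k : Fin r, j < k → lam k < lam j) ∧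
          (∀ j, 0 < lam j) ∧ (∀ j, lam j < 1)},
        (∏ j : Fin r,
            ((1 - ((lam j : ℂ)) ^ 2) ^ s * ((lam j ^ (2 * b + 1) : ℝ) : ℂ))) *
          ∏ j : Fin r, ∏ l ∈ Finset.Ioi j, (((lam j ^ 2 - lam l ^ 2) ^ a : ℝ) : ℂ))
    (hchi : ∀ s : ℂ, chi s =
      ∏ j : Fin r,
        (ascPochhammer ℂ (1 + b + (r - 1 - (j : ℕ)) * a)).eval
          (s + 1 + (j : ℂ) * ((a : ℂ) / 2))) :
    ∀ s : ℂ, -1 < s.re → chi s * F s = chi 0 * F 0 := by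
  obtain ⟨m, rfl⟩ : ∃ m, r = m + 1 := ⟨r - 1, by omega⟩
  have hM : ∀ s : ℂ, -1 < s.re → jacobiMoment s a b (∅ : Finset (Fin (m + 1))) =
      ((m + 1).factorial : ℂ) * F s := fun s hs => by
    rw [hF, jacobiMoment_empty_eq_factorial_mul hs]
  intro s hs
  have h := hypergeomChi_mul_jacobiMoment hs m a b
  rw [hM s hs, hM 0 (by simp)] at h
  have hne : ((m + 1).factorial : ℂ) ≠ 0 := by exact_mod_cast (m + 1).factorial_ne_zero
  rw [hchi s, hchi 0]
  change hypergeomChi (m + 1) a b s * F s = hypergeomChi (m + 1) a b 0 * F 0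
  refine mul_left_cancel₀ hne ?_
  linear_combination h
end

section
/- Let D be a semi-Reinhardt bounded domain in ℂ^m × ℂ^n. For each multi-index j = (j_1,…,j_m) ∈ ℕ^m and each k ∈ ℕ, let {P^{(j)}_{k1},…,P^{(j)}_{k m_k}}, with m_k = C(n+k-1, k), be a basis of the space of homogeneous polynomials of degree k in z_1,…,z_n which is orthonormal with respect to the weighted inner product (f|g)^{(j)} = ∫_D |w_1^{j_1}⋯w_m^{j_m}|^2 f(z) conj(g(z)) dV(w,z). Then the family { (w,z) ↦ w_1^{j_1}⋯w_m^{j_m} P^{(j)}_{ki}(z) : j ∈ ℕ^m, k ∈ ℕ, 1 ≤ i ≤ m_k } is a complete orthonormal system (a Hilbert basis) of the Bergman space A²(D). -/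
open MeasureTheory Complex

open Metric in
/-- Holomorphy under the integral sign for a compact parameter space. -/
theorem differentiableOn_integral_of_continuousOn {X : Type*} [TopologicalSpace X]
    [CompactSpace X] [SecondCountableTopology X] [MeasurableSpace X] [OpensMeasurableSpace X]
    (μ : Measure X) [IsFiniteMeasure μ] {U : Set ℂ} (hU : IsOpen U) {F : X → ℂ → ℂ}
    (hc : ContinuousOn (fun q : X × ℂ => F q.1 q.2) (Set.univ ×ˢ U))
    (hd : ∀ x, DifferentiableOn ℂ (F x) U) :
    DifferentiableOn ℂ (fun s => ∫ x, F x s ∂μ) U := by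
  intro s₀ hs₀
  obtain ⟨ε, hε, hεU⟩ := Metric.isOpen_iff.1 hU s₀ hs₀
  set ρ := ε / 3 with hρ_def
  have hρ : 0 < ρ := by positivity
  have hKU : closedBall s₀ (2 * ρ) ⊆ U :=
    (closedBall_subset_ball (by linarith)).trans hεU
  obtain ⟨M, hM⟩ := ((isCompact_univ (X := X)).prod
    (isCompact_closedBall s₀ (2 * ρ))).exists_bound_of_continuousOn
      (hc.mono (Set.prod_mono_right hKU))
  have hslice : ∀ s ∈ U, Continuous (fun x => F x s) := by
    intro s hs
    refine continuousOn_univ.1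
      (hc.comp (by fun_prop : Continuous fun x : X => (x, s)).continuousOn ?_)
    intro x _
    exact ⟨trivial, hs⟩
  have hmem : ∀ s ∈ ball s₀ ρ, closedBall s ρ ⊆ closedBall s₀ (2 * ρ) := by
    intro s hs
    exact closedBall_subset_closedBall' (by have := mem_ball.1 hs; linarith)
  have hsub : ball s₀ ρ ⊆ U :=
    fun s hs => hKU (hmem s hs (mem_closedBall_self hρ.le))
  have hderiv : ∀ x, ∀ s ∈ ball s₀ ρ, HasDerivAt (F x) (deriv (F x) s) s := fun x s hs =>
    ((hd x).differentiableAt (hU.mem_nhds (hsub hs))).hasDerivAt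
  have hmeas : AEStronglyMeasurable (fun x => deriv (F x) s₀) μ := by
    let u : ℕ → ℂ := fun n => ((ρ / 2 / (n + 1 : ℝ) : ℝ) : ℂ)
    have hu0 : Filter.Tendsto u Filter.atTop (nhds 0) := by
      have h := (tendsto_const_div_atTop_nhds_zero_nat (ρ / 2)).comp (Filter.tendsto_add_atTop_nat 1)
      have h2 := (Complex.continuous_ofReal.tendsto 0).comp h
      simpa [u, Function.comp_def] using h2
    have hune : ∀ n, u n ≠ 0 := by
      intro n
      simp only [u, ne_eq, Complex.ofReal_eq_zero]
      positivity
    have hub : ∀ n, s₀ + u n ∈ ball s₀ ρ := by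
      intro n
      simp only [u, mem_ball, dist_self_add_left, Complex.norm_real, Real.norm_eq_abs]
      rw [abs_of_pos (by positivity), div_lt_iff₀ (by positivity)]
      nlinarith [(Nat.cast_nonneg n : (0 : ℝ) ≤ n)]
    refine aestronglyMeasurable_of_tendsto_ae (u := Filter.atTop)
      (f := fun n x => (u n)⁻¹ * (F x (s₀ + u n) - F x s₀)) ?_ ?_
    · intro n
      exact (continuous_const.mul
        ((hslice _ (hsub (hub n))).sub (hslice _ hs₀))).aestronglyMeasurable
    · refine Filter.Eventually.of_forall fun x => ?_
      have := (hasDerivAt_iff_tendsto_slope_zero.1 (hderiv x s₀ (mem_ball_self hρ)))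
      refine this.comp (tendsto_nhdsWithin_iff.2 ⟨hu0, ?_⟩)
      exact Filter.Eventually.of_forall hune
  have hmain := hasDerivAt_integral_of_dominated_loc_of_deriv_le (μ := μ) (𝕜 := ℂ)
    (F := fun s x => F x s) (F' := fun s x => deriv (F x) s) (bound := fun _ => M / ρ)
    (ball_mem_nhds s₀ hρ) ?_ ?_ hmeas ?_ (integrable_const _) ?_
  · exact hmain.2.differentiableAt.differentiableWithinAt
  · filter_upwards [hU.mem_nhds hs₀] with s hs
    exact (hslice s hs).aestronglyMeasurable
  · exact (hslice s₀ hs₀).integrable_of_hasCompactSupport (HasCompactSupport.of_compactSpace _)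
  · refine Filter.Eventually.of_forall fun x s hs => ?_
    refine norm_deriv_le_of_forall_mem_sphere_norm_le hρ ?_ ?_
    · refine DifferentiableOn.diffContOnCl_ball (U := U) (hd x) ((hmem s hs).trans hKU)
    · intro z hz
      exact hM (x, z) ⟨trivial, hmem s hs (sphere_subset_closedBall hz)⟩
  · exact Filter.Eventually.of_forall fun x s hs => hderiv x s hs

section Torus

variable {κ ι : Type*}

/-- Continuous on `D` and holomorphic along every complex line. -/
def IsLineHol (f : (κ → ℂ) → ℂ) (D : Set (κ → ℂ)) : Prop :=
  ContinuousOn f D ∧ ∀ p v : κ → ℂ,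
    DifferentiableOn ℂ (fun s : ℂ => f (p + s • v)) ((fun s : ℂ => p + s • v) ⁻¹' D)

theorem IsLineHol.mono {f : (κ → ℂ) → ℂ} {D D' : Set (κ → ℂ)} (hf : IsLineHol f D)
    (h : D' ⊆ D) : IsLineHol f D' :=
  ⟨hf.1.mono h, fun p v => (hf.2 p v).mono (Set.preimage_mono h)⟩

theorem IsLineHol.sub {f g : (κ → ℂ) → ℂ} {D : Set (κ → ℂ)} (hf : IsLineHol f D)
    (hg : IsLineHol g D) : IsLineHol (fun v => f v - g v) D :=
  ⟨hf.1.sub hg.1, fun p v => (hf.2 p v).sub (hg.2 p v)⟩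

variable [Fintype κ]

theorem isLineHol_of_differentiableOn {f : (κ → ℂ) → ℂ} {D : Set (κ → ℂ)}
    (hf : DifferentiableOn ℂ f D) : IsLineHol f D :=
  ⟨hf.continuousOn, fun p v => hf.comp
    (by fun_prop : Differentiable ℂ fun s : ℂ => p + s • v).differentiableOn fun _ h => h⟩

open Metric in
/-- The identity theorem for functions holomorphic along lines. -/
theorem IsLineHol.eqOn_zero {h : (κ → ℂ) → ℂ} {D : Set (κ → ℂ)} (hh : IsLineHol h D)
    (hD : IsOpen D) (hDc : IsPreconnected D) {p₀ : κ → ℂ} (hp₀ : p₀ ∈ D)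
    (h0 : ∀ᶠ v in nhds p₀, h v = 0) : ∀ v ∈ D, h v = 0 := by
  let u : Set (κ → ℂ) := {p | ∀ᶠ v in nhds p, h v = 0}
  have hu : IsOpen u := isOpen_setOfPred_eventually_nhds
  suffices D ⊆ u from fun v hv => (this hv).self_of_nhds
  refine hDc.subset_of_closure_inter_subset hu ⟨p₀, hp₀, h0⟩ ?_
  rintro p ⟨hpcl, hpD⟩
  obtain ⟨r, hr, hrD⟩ := Metric.isOpen_iff.1 hD p hpD
  obtain ⟨q, hq, hqu⟩ := mem_closure_iff.1 hpcl (ball p r) isOpen_ball (mem_ball_self hr)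
  filter_upwards [ball_mem_nhds p hr] with x hx
  have hcont : Continuous fun s : ℂ => q + s • (x - q) := by fun_prop
  let W : Set ℂ := (fun s : ℂ => q + s • (x - q)) ⁻¹' ball p r
  have hWo : IsOpen W := isOpen_ball.preimage hcont
  have hWc : Convex ℝ W := by
    intro a ha b hb α β hα hβ hαβ
    have := (convex_ball p r) ha hb hα hβ hαβ
    change q + (α • a + β • b) • (x - q) ∈ ball p r
    convert this using 1
    ext i
    have hαβ' : (α : ℂ) + β = 1 := by exact_mod_cast hαβ
    simp only [Pi.add_apply, Pi.smul_apply, Pi.sub_apply, smul_eq_mul, real_smul]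
    linear_combination (-(q i)) * hαβ'
  have han : AnalyticOnNhd ℂ (fun s : ℂ => h (q + s • (x - q))) W :=
    ((hh.2 q (x - q)).mono (Set.preimage_mono hrD)).analyticOnNhd hWo
  have h0W : (0 : ℂ) ∈ W := by simpa [W] using hq
  have h1W : (1 : ℂ) ∈ W := by simpa [W] using hx
  have hev : (fun s : ℂ => h (q + s • (x - q))) =ᶠ[nhds 0] 0 := by
    have : Filter.Tendsto (fun s : ℂ => q + s • (x - q)) (nhds 0) (nhds q) := by
      simpa using hcont.tendsto 0
    exact this.eventually hqu
  have := han.eqOn_zero_of_preconnected_of_eventuallyEq_zero hWc.isPreconnected h0W hev h1W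
  simpa using this

noncomputable local instance : MeasureSpace UnitAddCircle := ⟨AddCircle.haarAddCircle⟩

local instance : Measure.IsAddHaarMeasure (volume : Measure UnitAddCircle) :=
  inferInstanceAs (Measure.IsAddHaarMeasure AddCircle.haarAddCircle)

local instance : IsProbabilityMeasure (volume : Measure UnitAddCircle) :=
  inferInstanceAs (IsProbabilityMeasure AddCircle.haarAddCircle)

/-- The action of the torus `(ℝ/ℤ)^ι` on `ℂ^κ` rotating the coordinate `x` by the angle `t (c x)`. -/
noncomputable def torusRot (c : κ → ι) (t : UnitAddTorus ι) (v : κ → ℂ) : κ → ℂ :=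
  fun x => (AddCircle.toCircle (t (c x)) : ℂ) * v x

omit [Fintype κ] in
theorem torusRot_add (c : κ → ι) (s t : UnitAddTorus ι) (v : κ → ℂ) :
    torusRot c (s + t) v = torusRot c s (torusRot c t v) := by
  ext x
  simp [torusRot, AddCircle.toCircle_add, mul_assoc]

omit [Fintype κ] in
@[simp] theorem torusRot_zero (c : κ → ι) (v : κ → ℂ) : torusRot c 0 v = v := by
  ext x
  simp [torusRot]

omit [Fintype κ] in
theorem continuous_torusRot (c : κ → ι) :
    Continuous fun q : UnitAddTorus ι × (κ → ℂ) => torusRot c q.1 q.2 := by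
  refine continuous_pi fun x => ?_
  have : Continuous fun y : UnitAddCircle => (AddCircle.toCircle y : ℂ) :=
    continuous_subtype_val.comp AddCircle.continuous_toCircle
  exact (this.comp (by fun_prop)).mul (by fun_prop)

omit [Fintype κ] in
theorem torusRot_line (c : κ → ι) (t : UnitAddTorus ι) (p v : κ → ℂ) (s : ℂ) :
    torusRot c t (p + s • v) = torusRot c t p + s • torusRot c t v := by
  ext x
  simp [torusRot]
  ring

theorem norm_torusRot (c : κ → ι) (t : UnitAddTorus ι) (v : κ → ℂ) :
    ‖torusRot c t v‖ = ‖v‖ := by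
  have : ∀ x : UnitAddCircle, ‖(AddCircle.toCircle x : ℂ)‖₊ = 1 := fun x => by
    ext
    exact Circle.norm_coe _
  simp [torusRot, Pi.norm_def, nnnorm_mul, this]

theorem measurePreserving_torusRot (c : κ → ι) (t : UnitAddTorus ι) :
    MeasurePreserving (torusRot c t) (volume : Measure (κ → ℂ)) volume := by
  refine volume_preserving_pi (f := fun x z => (AddCircle.toCircle (t (c x)) : ℂ) * z) fun x => ?_
  exact (rotation (AddCircle.toCircle (t (c x)))).measurePreserving

/-- Invariance of a set under the torus action. -/
def IsTorusInvariant (c : κ → ι) (D : Set (κ → ℂ)) : Prop :=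
  ∀ t, ∀ v ∈ D, torusRot c t v ∈ D

omit [Fintype κ] in
theorem IsTorusInvariant.preimage_eq {c : κ → ι} {D : Set (κ → ℂ)} (hD : IsTorusInvariant c D)
    (t : UnitAddTorus ι) : torusRot c t ⁻¹' D = D := by
  ext v
  refine ⟨fun h => ?_, hD t v⟩
  have := hD (-t) _ h
  rwa [← torusRot_add, neg_add_cancel, torusRot_zero] at this

theorem isTorusInvariant_ball (c : κ → ι) (R : ℝ) :
    IsTorusInvariant c (Metric.ball (0 : κ → ℂ) R) := by
  intro t v hv
  simpa [norm_torusRot] using hv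

omit [Fintype κ] in
theorem continuousOn_comp_torusRot {c : κ → ι} {f : (κ → ℂ) → ℂ} {D : Set (κ → ℂ)}
    (hf : ContinuousOn f D) (hD : IsTorusInvariant c D) :
    ContinuousOn (fun q : UnitAddTorus ι × (κ → ℂ) => f (torusRot c q.1 q.2))
      (Set.univ ×ˢ D) :=
  hf.comp (continuous_torusRot c).continuousOn fun q hq => hD q.1 q.2 hq.2

open UnitAddTorus

variable [Fintype ι]

theorem mFourier_apply_add (χ : ι → ℤ) (s t : UnitAddTorus ι) :
    mFourier χ (s + t) = mFourier χ s * mFourier χ t := by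
  simp [mFourier, fourier_apply, smul_add, AddCircle.toCircle_add, Finset.prod_mul_distrib]

theorem mFourier_apply_zero (χ : ι → ℤ) : mFourier χ (0 : UnitAddTorus ι) = 1 := by
  simp [mFourier, fourier_apply]

theorem mFourier_neg_apply_neg (χ : ι → ℤ) (t : UnitAddTorus ι) :
    mFourier (-χ) (-t) = mFourier χ t := by
  simp [mFourier, fourier_apply]

/-- The component of `f` on which the torus acts through the character `χ`. -/
noncomputable def isotypic (c : κ → ι) (χ : ι → ℤ) (f : (κ → ℂ) → ℂ) (v : κ → ℂ) : ℂ :=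
  mFourierCoeff (fun t => f (torusRot c t v)) χ

/-- `f` transforms under the torus action on `D` by the character `χ`. -/
def IsEquivariant (c : κ → ι) (χ : ι → ℤ) (f : (κ → ℂ) → ℂ) (D : Set (κ → ℂ)) : Prop :=
  ∀ t, ∀ v ∈ D, f (torusRot c t v) = mFourier χ t * f v

omit [Fintype κ] in
theorem isEquivariant_isotypic (c : κ → ι) (χ : ι → ℤ) (f : (κ → ℂ) → ℂ) (D : Set (κ → ℂ)) :
    IsEquivariant c χ (isotypic c χ f) D := by
  intro s v _
  simp only [isotypic, mFourierCoeff, smul_eq_mul, ← torusRot_add]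
  rw [← integral_add_right_eq_self (μ := (volume : Measure (UnitAddTorus ι))) _ (-s),
    ← integral_const_mul]
  congr 1
  ext t
  rw [neg_add_cancel_right, mFourier_apply_add, mFourier_neg_apply_neg]
  ring

theorem isLineHol_isotypic {c : κ → ι} {f : (κ → ℂ) → ℂ} {D : Set (κ → ℂ)}
    (hf : IsLineHol f D) (hDo : IsOpen D) (hD : IsTorusInvariant c D) (χ : ι → ℤ) :
    IsLineHol (isotypic c χ f) D := by
  have hcont : ContinuousOn (fun q : UnitAddTorus ι × (κ → ℂ) =>
      mFourier (-χ) q.1 • f (torusRot c q.1 q.2)) (Set.univ ×ˢ D) :=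
    ((mFourier (-χ)).continuous.comp continuous_fst).continuousOn.smul
      (continuousOn_comp_torusRot hf.1 hD)
  constructor
  · rw [continuousOn_iff_continuous_domRestrict]
    have : LocallyCompactSpace D := hDo.locallyCompactSpace
    have h2 : Continuous (Function.uncurry fun (v : D) (t : UnitAddTorus ι) =>
        mFourier (-χ) t • f (torusRot c t v)) :=
      hcont.comp_continuous (f := fun q : D × UnitAddTorus ι => (q.2, (q.1 : κ → ℂ)))
        (by fun_prop) fun q => ⟨trivial, q.1.2⟩
    have h3 := continuous_parametric_integral_of_continuous
      (μ := (volume : Measure (UnitAddTorus ι))) h2 isCompact_univ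
    simp only [Measure.restrict_univ] at h3
    exact h3
  · intro p v
    have hline : Continuous fun s : ℂ => p + s • v := by fun_prop
    refine differentiableOn_integral_of_continuousOn volume (hDo.preimage hline)
      (F := fun t s => mFourier (-χ) t • f (torusRot c t (p + s • v))) ?_ ?_
    · refine hcont.comp (f := fun q : UnitAddTorus ι × ℂ => (q.1, p + q.2 • v))
        (by fun_prop) fun q hq => ⟨trivial, hq.2⟩
    · intro t
      simp_rw [torusRot_line, smul_eq_mul]
      refine DifferentiableOn.const_mul ?_ _
      refine (hf.2 (torusRot c t p) (torusRot c t v)).mono ?_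
      intro s hs
      change torusRot c t p + s • torusRot c t v ∈ D
      rw [← torusRot_line]
      exact hD t _ hs

open Metric in
/-- A holomorphic function on a disc whose restriction to the unit circle is a multiple of a
character is a monomial, and vanishes if the character is negative. -/
theorem eq_monomial_of_circle {φ : ℂ → ℂ} (hφ : DifferentiableOn ℂ φ (ball 0 2)) {k : ℤ}
    (hk : ∀ y : UnitAddCircle, φ (AddCircle.toCircle y) = fourier k y * φ 1) :
    (k < 0 → φ 1 = 0) ∧ ∀ b : ℕ, k = b → ∀ a ∈ closedBall (0 : ℂ) 1, φ a = a ^ b * φ 1 := by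
  have hcirc : ∀ z ∈ sphere (0 : ℂ) 1, ∃ y : UnitAddCircle, (AddCircle.toCircle y : ℂ) = z := by
    intro z hz
    obtain ⟨y, hy⟩ := (AddCircle.homeomorphCircle (one_ne_zero : (1 : ℝ) ≠ 0)).surjective
      ⟨z, by simpa [Submonoid.unitSphere] using hz⟩
    refine ⟨y, ?_⟩
    rw [← AddCircle.homeomorphCircle_apply one_ne_zero, hy]
  have hsub : closedBall (0 : ℂ) 1 ⊆ ball 0 2 := closedBall_subset_ball (by norm_num)
  have key : ∀ ψ₁ ψ₂ : ℂ → ℂ, DifferentiableOn ℂ ψ₁ (ball 0 2) → DifferentiableOn ℂ ψ₂ (ball 0 2) →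
      (∀ z ∈ sphere (0 : ℂ) 1, ψ₁ z = ψ₂ z) → ∀ a ∈ closedBall (0 : ℂ) 1, ψ₁ a = ψ₂ a := by
    intro ψ₁ ψ₂ h₁ h₂ h a ha
    rw [← closure_ball (0 : ℂ) one_ne_zero] at ha
    refine eqOn_closure_of_eqOn_frontier isBounded_ball (h₁.diffContOnCl_ball hsub)
      (h₂.diffContOnCl_ball hsub) ?_ ha
    rwa [frontier_ball (0 : ℂ) one_ne_zero]
  have hfour : ∀ (n : ℤ) (y : UnitAddCircle),
      fourier n y = (AddCircle.toCircle y : ℂ) ^ n := by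
    intro n y
    rw [fourier_apply, AddCircle.toCircle_zsmul, Circle.coe_zpow]
  constructor
  · intro hneg
    obtain ⟨b, rfl⟩ : ∃ b : ℕ, k = -(b + 1 : ℕ) := ⟨(-k - 1).toNat, by omega⟩
    have := key (fun a => a ^ (b + 1) * φ a) (fun _ => φ 1)
      ((differentiableOn_id.pow _).mul hφ) (differentiableOn_const _) ?_ 0 (by simp)
    · simpa using this.symm
    · intro z hz
      obtain ⟨y, rfl⟩ := hcirc z hz
      have hne : (AddCircle.toCircle y : ℂ) ≠ 0 := Circle.coe_ne_zero _
      simp only [hk, hfour, zpow_neg, zpow_natCast]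
      field_simp
  · rintro b rfl
    refine key φ (fun a => a ^ b * φ 1) hφ (by fun_prop) ?_
    intro z hz
    obtain ⟨y, rfl⟩ := hcirc z hz
    simp only [hk, hfour, zpow_natCast]

omit [Fintype κ] [Fintype ι] in
theorem mFourier_id_single [Fintype κ] [DecidableEq κ] (β : κ → ℤ) (x : κ) (y : UnitAddCircle) :
    mFourier β (Pi.single x y) = fourier (β x) y := by
  simp only [mFourier, ContinuousMap.coe_mk]
  rw [Finset.prod_eq_single x]
  · simp
  · intro b _ hb
    simp [Pi.single_eq_of_ne hb, fourier_apply]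
  · simp

open Metric in
/-- Homogeneity in one coordinate of an equivariant function for the full torus. -/
theorem IsEquivariant.update [DecidableEq κ] {h : (κ → ℂ) → ℂ} {r : ℝ} {β : κ → ℤ}
    (hh : IsLineHol h (ball 0 (3 * r))) (he : IsEquivariant id β h (ball 0 (3 * r))) (hr : 0 < r)
    {v : κ → ℂ} (hv : v ∈ closedBall (0 : κ → ℂ) r) (x : κ) :
    (β x < 0 → h v = 0) ∧ ∀ b : ℕ, β x = b → ∀ a ∈ closedBall (0 : ℂ) 1,
      h (Function.update v x (a * v x)) = a ^ b * h v := by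
  let w : κ → ℂ := Pi.single x (v x)
  have hline : ∀ a : ℂ, Function.update v x (a * v x)
      = Function.update v x 0 + a • w := by
    intro a
    ext y
    by_cases hy : y = x
    · subst hy; simp [w]
    · simp [w, hy]
  have hv' : ∀ y, ‖v y‖ ≤ r := fun y => (norm_le_pi_norm v y).trans (by simpa using hv)
  have hφ : DifferentiableOn ℂ (fun a : ℂ => h (Function.update v x (a * v x))) (ball 0 2) := by
    have heq : (fun a : ℂ => h (Function.update v x (a * v x)))
        = fun a : ℂ => h (Function.update v x 0 + a • w) := by
      ext a
      rw [hline]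
    rw [heq]
    refine (hh.2 (Function.update v x 0) w).mono fun a ha => ?_
    rw [Set.mem_preimage, ← hline, mem_ball_zero_iff, pi_norm_lt_iff (by positivity)]
    intro y
    by_cases hy : y = x
    · subst hy
      have ha' : ‖a‖ < 2 := by simpa using ha
      simp only [Function.update_self, norm_mul]
      nlinarith [hv' y, norm_nonneg a, norm_nonneg (v y)]
    · rw [Function.update_of_ne hy]
      linarith [hv' y]
  have := eq_monomial_of_circle hφ (k := β x) ?_
  · simpa using this
  · intro y
    have hvb : v ∈ ball (0 : κ → ℂ) (3 * r) :=
      closedBall_subset_ball (by linarith) hv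
    have := he (Pi.single x y) v hvb
    rw [mFourier_id_single] at this
    simp only [one_mul, Function.update_eq_self]
    rw [← this]
    congr 1
    ext z
    by_cases hz : z = x
    · subst hz; simp [torusRot]
    · simp [torusRot, hz]

open Metric in
theorem IsEquivariant.eq_zero_of_neg {h : (κ → ℂ) → ℂ} {r : ℝ} {β : κ → ℤ}
    (hh : IsLineHol h (ball 0 (3 * r))) (he : IsEquivariant id β h (ball 0 (3 * r))) (hr : 0 < r)
    {v : κ → ℂ} (hv : v ∈ closedBall (0 : κ → ℂ) r) {x : κ} (hx : β x < 0) : h v = 0 := by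
  classical
  exact (he.update hh hr hv x).1 hx

open Metric in
theorem IsEquivariant.eq_monomial {h : (κ → ℂ) → ℂ} {r : ℝ} {b : κ → ℕ}
    (hh : IsLineHol h (ball 0 (3 * r)))
    (he : IsEquivariant id (fun x => (b x : ℤ)) h (ball 0 (3 * r))) (hr : 0 < r)
    {v : κ → ℂ} (hv : v ∈ closedBall (0 : κ → ℂ) r) :
    h v = (∏ x, v x ^ b x) * (h (fun _ => (r : ℂ)) / ∏ x, (r : ℂ) ^ b x) := by
  classical
  have hrC : (r : ℂ) ≠ 0 := by exact_mod_cast hr.ne'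
  have hv' : ∀ y, ‖v y‖ ≤ r := fun y => (norm_le_pi_norm v y).trans (by simpa using hv)
  have hnr : ‖(r : ℂ)‖ = r := by simp [abs_of_pos hr]
  have key : ∀ s : Finset κ, h (s.piecewise v fun _ => (r : ℂ))
      = (∏ x ∈ s, (v x / r) ^ b x) * h (fun _ => (r : ℂ)) := by
    intro s
    induction s using Finset.induction_on with
    | empty => simp
    | insert x s hx ih =>
      have hmem : s.piecewise v (fun _ => (r : ℂ)) ∈ closedBall (0 : κ → ℂ) r := by
        rw [mem_closedBall_zero_iff, pi_norm_le_iff_of_nonneg hr.le]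
        intro y
        by_cases hy : y ∈ s
        · simpa [hy] using hv' y
        · simp [hy, abs_of_pos hr]
      have ha : v x / r ∈ closedBall (0 : ℂ) 1 := by
        rw [mem_closedBall_zero_iff, norm_div, hnr]
        exact div_le_one_of_le₀ (hv' x) hr.le
      have := (he.update hh hr hmem x).2 (b x) rfl _ ha
      rw [Finset.piecewise_eq_of_notMem _ _ _ hx, div_mul_cancel₀ _ hrC,
        ← Finset.piecewise_insert] at this
      rw [this, ih, Finset.prod_insert hx, mul_assoc]
  have := key Finset.univ
  rw [Finset.piecewise_univ] at this
  rw [this]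
  simp only [div_pow, Finset.prod_div_distrib]
  ring

omit [Fintype ι] in
/-- The character of the torus on `ι` obtained by restriction of a character of the full torus. -/
def pushWeight [DecidableEq ι] (c : κ → ι) (β : κ → ℤ) (i : ι) : ℤ :=
  ∑ x with c x = i, β x

theorem mFourier_comp [DecidableEq ι] (c : κ → ι) (β : κ → ℤ) (s : UnitAddTorus ι) :
    mFourier β (fun x => s (c x)) = mFourier (pushWeight c β) s := by
  simp only [mFourier, ContinuousMap.coe_mk]
  rw [← Finset.prod_fiberwise Finset.univ c]
  refine Finset.prod_congr rfl fun i _ => ?_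
  have : ∀ S : Finset κ, ∏ x ∈ S, fourier (β x) (s i) = fourier (∑ x ∈ S, β x) (s i) := by
    classical
    intro S
    induction S using Finset.induction_on with
    | empty => simp
    | insert x S hx ih => rw [Finset.prod_insert hx, Finset.sum_insert hx, ih, fourier_add]
  rw [pushWeight, ← this]
  refine Finset.prod_congr rfl fun x hx => ?_
  rw [(Finset.mem_filter.1 hx).2]

theorem mFourier_injective : Function.Injective (mFourier : (ι → ℤ) → C(UnitAddTorus ι, ℂ)) := by
  intro m n h
  refine (orthonormal_mFourier (d := ι)).linearIndependent.injective ?_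
  simp only [mFourierLp, h]

theorem isEquivariant_monomial [DecidableEq ι] (c : κ → ι) (b : κ → ℕ) (D : Set (κ → ℂ)) :
    IsEquivariant c (pushWeight c fun x => (b x : ℤ)) (fun v => ∏ x, v x ^ b x) D := by
  intro t v _
  rw [← mFourier_comp]
  simp only [mFourier, ContinuousMap.coe_mk, torusRot, mul_pow, Finset.prod_mul_distrib,
    fourier_apply, AddCircle.toCircle_zsmul, zpow_natCast, Circle.coe_pow]

/-- The exponents of the monomials of weight `χ`. -/
noncomputable def weightExponents [DecidableEq κ] [DecidableEq ι] (c : κ → ι) (χ : ι → ℤ) :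
    Finset (κ → ℕ) :=
  (Fintype.piFinset fun x => Finset.range ((χ (c x)).toNat + 1)).filter
    fun b => pushWeight c (fun x => (b x : ℤ)) = χ

theorem mem_weightExponents [DecidableEq κ] [DecidableEq ι] {c : κ → ι} {χ : ι → ℤ}
    {b : κ → ℕ} :
    b ∈ weightExponents c χ ↔ pushWeight c (fun x => (b x : ℤ)) = χ := by
  simp only [weightExponents, Finset.mem_filter, Fintype.mem_piFinset, Finset.mem_range,
    and_iff_right_iff_imp]
  rintro rfl x
  have : (b x : ℤ) ≤ pushWeight c (fun x => (b x : ℤ)) (c x) :=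
    Finset.single_le_sum (f := fun x => (b x : ℤ)) (fun _ _ => by positivity) (by simp)
  omega

open Metric in
/-- Near the origin an equivariant holomorphic function is a polynomial. -/
theorem IsEquivariant.eq_polynomial_ball [DecidableEq κ] [DecidableEq ι] {c : κ → ι} {χ : ι → ℤ}
    {h : (κ → ℂ) → ℂ} {r : ℝ} (hh : IsLineHol h (ball 0 (3 * r)))
    (he : IsEquivariant c χ h (ball 0 (3 * r))) (hr : 0 < r) :
    ∃ C : (κ → ℕ) → ℂ, ∀ v ∈ closedBall (0 : κ → ℂ) r,
      h v = ∑ b ∈ weightExponents c χ, C b * ∏ x, v x ^ b x := by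
  let g : (κ → ℤ) → (κ → ℂ) → ℂ := fun β => isotypic id β h
  have hginv := isTorusInvariant_ball (id : κ → κ) (3 * r)
  have hg : ∀ β, IsLineHol (g β) (ball 0 (3 * r)) := fun β =>
    isLineHol_isotypic hh isOpen_ball hginv β
  have hge : ∀ β, IsEquivariant id β (g β) (ball 0 (3 * r)) := fun β =>
    isEquivariant_isotypic id β h _
  have hsub : closedBall (0 : κ → ℂ) r ⊆ ball 0 (3 * r) := closedBall_subset_ball (by linarith)
  have hsupp : ∀ β, ∀ v ∈ closedBall (0 : κ → ℂ) r, g β v ≠ 0 →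
      ∃ b ∈ weightExponents c χ, (fun x => ((b x : ℕ) : ℤ)) = β := by
    intro β v hv hne
    have hpos : ∀ x, 0 ≤ β x := by
      intro x
      by_contra! hx
      exact hne ((hge β).eq_zero_of_neg (hg β) hr hv hx)
    refine ⟨fun x => (β x).toNat, ?_, by ext x; simp [hpos x]⟩
    rw [mem_weightExponents]
    have hβ : (fun x => (((β x).toNat : ℕ) : ℤ)) = β := by ext x; simp [hpos x]
    rw [hβ]
    refine mFourier_injective (ContinuousMap.ext fun s => ?_)
    rw [← mFourier_comp]
    have h1 := hge β (fun x => s (c x)) v (hsub hv)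
    have h2 : g β (torusRot id (fun x => s (c x)) v) = mFourier χ s * g β v := by
      simp only [g, isotypic, mFourierCoeff, smul_eq_mul]
      rw [← integral_const_mul]
      congr 1
      ext t
      have : torusRot id t (torusRot id (fun x => s (c x)) v) = torusRot c s (torusRot id t v) := by
        ext x
        simp only [torusRot, id]
        ring
      rw [this, he s _ (hginv t v (hsub hv))]
      ring
    exact mul_right_cancel₀ hne (h1.symm.trans h2)
  refine ⟨fun b => g (fun x => (b x : ℤ)) (fun _ => (r : ℂ)) / ∏ x, (r : ℂ) ^ b x, fun v hv => ?_⟩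
  let H : C(UnitAddTorus κ, ℂ) := ⟨fun t => h (torusRot id t v),
    (continuousOn_comp_torusRot hh.1 hginv).comp_continuous
      (f := fun t : UnitAddTorus κ => (t, v)) (by fun_prop) fun t => ⟨trivial, hsub hv⟩⟩
  have hH : ∀ β, mFourierCoeff H β = g β v := fun β => rfl
  let e : (κ → ℕ) ↪ (κ → ℤ) := ⟨fun b x => (b x : ℤ), fun b b' hb => by
    ext x
    simpa using congrFun hb x⟩
  have hz : ∀ β ∉ (weightExponents c χ).map e, mFourierCoeff H β = 0 := by
    intro β hβ
    by_contra hne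
    rw [hH] at hne
    obtain ⟨b, hb, rfl⟩ := hsupp β v hv hne
    exact hβ (Finset.mem_map_of_mem e hb)
  have hsum := hasSum_mFourier_series_apply_of_summable
    (f := H) (summable_of_ne_finset_zero hz) 0
  have hfin := hasSum_sum_of_ne_finset_zero
    (L := SummationFilter.unconditional _) (s := (weightExponents c χ).map e)
    (f := fun β => mFourierCoeff H β • mFourier β (0 : UnitAddTorus κ))
    fun β hβ => by rw [hz β hβ, zero_smul]
  have := hsum.unique hfin
  have hH0 : H 0 = h v := by simp [H]
  rw [hH0] at this
  rw [this, Finset.sum_map]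
  refine Finset.sum_congr rfl fun b _ => ?_
  rw [mFourier_apply_zero, hH, smul_eq_mul, mul_one]
  rw [(hge (e b)).eq_monomial (hg _) hr hv]
  exact mul_comm _ _

open Metric in
/-- An equivariant holomorphic function on a domain containing the origin is a polynomial. -/
theorem IsEquivariant.eq_polynomial [DecidableEq κ] [DecidableEq ι] {c : κ → ι} {χ : ι → ℤ}
    {h : (κ → ℂ) → ℂ} {D : Set (κ → ℂ)} (hh : IsLineHol h D) (he : IsEquivariant c χ h D)
    (hDo : IsOpen D) (hDc : IsPreconnected D) (hD0 : 0 ∈ D) :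
    ∃ C : (κ → ℕ) → ℂ, ∀ v ∈ D,
      h v = ∑ b ∈ weightExponents c χ, C b * ∏ x, v x ^ b x := by
  obtain ⟨R, hR, hRD⟩ := Metric.isOpen_iff.1 hDo 0 hD0
  have hR3 : 3 * (R / 3) = R := by ring
  have hRD' : ball (0 : κ → ℂ) (3 * (R / 3)) ⊆ D := by rwa [hR3]
  obtain ⟨C, hC⟩ := IsEquivariant.eq_polynomial_ball (hh.mono hRD')
    (fun t v hv => he t v (hRD' hv)) (by positivity)
  refine ⟨C, fun v hv => sub_eq_zero.1 ?_⟩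
  have hpoly : IsLineHol (fun v : κ → ℂ =>
      ∑ b ∈ weightExponents c χ, C b * ∏ x, v x ^ b x) D :=
    isLineHol_of_differentiableOn
      (DifferentiableOn.fun_sum fun b _ => DifferentiableOn.const_mul
        (fun v _ => (HasFDerivAt.finsetProd fun x _ =>
          (by fun_prop : DifferentiableAt ℂ (fun v : κ → ℂ => v x ^ b x) v).hasFDerivAt
          ).differentiableAt.differentiableWithinAt) (C b))
  refine (hh.sub hpoly).eqOn_zero hDo hDc hD0 ?_ v hv
  filter_upwards [closedBall_mem_nhds (0 : κ → ℂ) (by positivity : 0 < R / 3)] with v hv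
  rw [hC v hv, sub_self]

/-- Parseval's identity on the torus for continuous functions, with values in `ℝ≥0∞`. -/
theorem tsum_enorm_sq_mFourierCoeff (H : C(UnitAddTorus ι, ℂ)) :
    ∑' χ, ‖mFourierCoeff H χ‖ₑ ^ 2 = ∫⁻ t, ‖H t‖ₑ ^ 2 := by
  have h := hasSum_sq_mFourierCoeff (ContinuousMap.toLp (E := ℂ) 2 volume ℂ H)
  simp only [mFourierCoeff_toLp] at h
  have hae : ∫ t, ‖(ContinuousMap.toLp (E := ℂ) 2 volume ℂ H) t‖ ^ 2 = ∫ t, ‖H t‖ ^ 2 := by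
    refine integral_congr_ae ?_
    filter_upwards [ContinuousMap.coeFn_toLp (𝕜 := ℂ) (p := 2) volume H] with t ht
    rw [ht]
  rw [hae] at h
  have hint : Integrable (fun t => ‖H t‖ ^ 2) (volume : Measure (UnitAddTorus ι)) :=
    (by fun_prop : Continuous fun t => ‖H t‖ ^ 2).integrable_of_hasCompactSupport
      (HasCompactSupport.of_compactSpace _)
  have hsq : ∀ z : ℂ, ‖z‖ₑ ^ 2 = ENNReal.ofReal (‖z‖ ^ 2) := fun z => by
    rw [ENNReal.ofReal_pow (norm_nonneg z), ofReal_norm]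
  simp only [hsq]
  rw [← ofReal_integral_eq_lintegral_ofReal hint (Filter.Eventually.of_forall fun t => by positivity),
    ← h.tsum_eq, ENNReal.ofReal_tsum_of_nonneg (fun χ => by positivity) h.summable]

/-- The shear `(t, v) ↦ (t, t • v)` preserves the product measure over an invariant set. -/
theorem measurePreserving_torusShear {c : κ → ι} {D : Set (κ → ℂ)} (hDm : MeasurableSet D)
    (hD : IsTorusInvariant c D) :
    MeasurePreserving (fun q : UnitAddTorus ι × (κ → ℂ) => (q.1, torusRot c q.1 q.2))
      ((volume : Measure (UnitAddTorus ι)).prod (volume.restrict D))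
      ((volume : Measure (UnitAddTorus ι)).prod (volume.restrict D)) := by
  refine (MeasurePreserving.id _).skew_product (g := fun t v => torusRot c t v)
    (continuous_torusRot c).measurable (Filter.Eventually.of_forall fun t => ?_)
  have := (measurePreserving_torusRot c t).restrict_preimage hDm
  rw [hD.preimage_eq] at this
  exact this.map_eq

omit [Fintype ι] in
theorem measurePreserving_torusRot_restrict {c : κ → ι} {D : Set (κ → ℂ)} (hDm : MeasurableSet D)
    (hD : IsTorusInvariant c D) (t : UnitAddTorus ι) :
    MeasurePreserving (torusRot c t) (volume.restrict D) (volume.restrict D) := by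
  have := (measurePreserving_torusRot c t).restrict_preimage hDm
  rwa [hD.preimage_eq] at this

omit [Fintype ι] in
theorem measurableEmbedding_torusRot (c : κ → ι) (t : UnitAddTorus ι) :
    MeasurableEmbedding (torusRot c t) := by
  have hc : ∀ s, Continuous (torusRot c s) := fun s =>
    (continuous_torusRot c).comp (by fun_prop : Continuous fun v : κ → ℂ => (s, v))
  let e : (κ → ℂ) ≃ₜ (κ → ℂ) :=
    { toFun := torusRot c t
      invFun := torusRot c (-t)
      left_inv := fun v => by simp [← torusRot_add]
      right_inv := fun v => by simp [← torusRot_add]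
      continuous_toFun := hc t
      continuous_invFun := hc (-t) }
  exact e.measurableEmbedding

/-- The isotypic components decompose the `L²` norm. -/
theorem lintegral_enorm_sq_eq_tsum_isotypic {c : κ → ι} {D : Set (κ → ℂ)} {f : (κ → ℂ) → ℂ}
    (hf : IsLineHol f D) (hDo : IsOpen D) (hD : IsTorusInvariant c D) :
    ∫⁻ v in D, ‖f v‖ₑ ^ 2 = ∑' χ : ι → ℤ, ∫⁻ v in D, ‖isotypic c χ f v‖ₑ ^ 2 := by
  have hDm := hDo.measurableSet
  have hmeas : ∀ g : (κ → ℂ) → ℂ, ContinuousOn g D →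
      AEMeasurable (fun v => ‖g v‖ₑ ^ 2) (volume.restrict D) := fun g hg =>
    (hg.aemeasurable hDm).enorm.pow_const 2
  rw [← lintegral_tsum fun χ => hmeas _ (isLineHol_isotypic hf hDo hD χ).1]
  have hpt : ∀ v ∈ D, ∑' χ : ι → ℤ, ‖isotypic c χ f v‖ₑ ^ 2
      = ∫⁻ t, ‖f (torusRot c t v)‖ₑ ^ 2 := by
    intro v hv
    let H : C(UnitAddTorus ι, ℂ) := ⟨fun t => f (torusRot c t v),
      (continuousOn_comp_torusRot hf.1 hD).comp_continuous
        (f := fun t : UnitAddTorus ι => (t, v)) (by fun_prop) fun t => ⟨trivial, hv⟩⟩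
    exact tsum_enorm_sq_mFourierCoeff H
  rw [setLIntegral_congr_fun hDm hpt]
  have hfm : AEMeasurable (fun q : UnitAddTorus ι × (κ → ℂ) => ‖f q.2‖ₑ ^ 2)
      ((volume : Measure (UnitAddTorus ι)).prod (volume.restrict D)) :=
    (hmeas f hf.1).comp_snd
  have hfm' : AEMeasurable (fun q : UnitAddTorus ι × (κ → ℂ) => ‖f (torusRot c q.1 q.2)‖ₑ ^ 2)
      ((volume : Measure (UnitAddTorus ι)).prod (volume.restrict D)) := by
    have hq := (measurePreserving_torusShear hDm hD).quasiMeasurePreserving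
    have := hfm.comp_quasiMeasurePreserving hq
    exact this
  rw [← lintegral_lintegral_swap hfm']
  have : ∀ t, ∫⁻ v in D, ‖f (torusRot c t v)‖ₑ ^ 2 = ∫⁻ v in D, ‖f v‖ₑ ^ 2 := fun t =>
    (measurePreserving_torusRot_restrict hDm hD t).lintegral_comp_emb
      (measurableEmbedding_torusRot c t) (fun v => ‖f v‖ₑ ^ 2)
  simp [this]

theorem integral_mFourier (χ : ι → ℤ) :
    ∫ t, mFourier χ t = if χ = 0 then 1 else 0 := by
  have := orthonormal_iff_ite.1 (orthonormal_mFourier (d := ι)) 0 χ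
  simp only [ContinuousMap.inner_toLp, ← mFourier_neg, ← mFourier_add] at this
  simpa [eq_comm] using this

/-- Pairing an isotypic component with an equivariant function. -/
theorem integral_isotypic_mul_conj {c : κ → ι} {D : Set (κ → ℂ)} {f Φ : (κ → ℂ) → ℂ}
    {χ : ι → ℤ} (hDm : MeasurableSet D) (hD : IsTorusInvariant c D)
    (hf : IntegrableOn f D) (hΦ : AEStronglyMeasurable Φ (volume.restrict D))
    (hΦe : IsEquivariant c χ Φ D) {M : ℝ} (hΦM : ∀ v ∈ D, ‖Φ v‖ ≤ M) (χ' : ι → ℤ) :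
    ∫ v in D, isotypic c χ' f v * (starRingEnd ℂ) (Φ v)
      = if χ' = χ then ∫ v in D, f v * (starRingEnd ℂ) (Φ v) else 0 := by
  let μ : Measure (UnitAddTorus ι × (κ → ℂ)) := volume.prod (volume.restrict D)
  have hconj : AEStronglyMeasurable (fun v => (starRingEnd ℂ) (Φ v)) (volume.restrict D) :=
    continuous_conj.comp_aestronglyMeasurable hΦ
  have hfint : Integrable (fun q : UnitAddTorus ι × (κ → ℂ) => f (torusRot c q.1 q.2)) μ :=
    (measurePreserving_torusShear hDm hD).integrable_comp_of_integrable (hf.comp_snd _)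
  have hG : Integrable (fun q : UnitAddTorus ι × (κ → ℂ) =>
      mFourier (-χ') q.1 * f (torusRot c q.1 q.2) * (starRingEnd ℂ) (Φ q.2)) μ := by
    have hn : ∀ t, ‖mFourier (-χ') t‖ ≤ 1 := fun t =>
      ((mFourier (-χ')).norm_coe_le_norm t).trans mFourier_norm.le
    refine (hfint.bdd_mul (c := 1) ?_ ?_).mul_bdd (c := M) ?_ ?_
    · exact ((mFourier (-χ')).continuous.comp continuous_fst).aestronglyMeasurable
    · exact Filter.Eventually.of_forall fun q => hn q.1
    · exact hconj.comp_snd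
    · have : ∀ᵐ v ∂volume.restrict D, ‖Φ v‖ ≤ M :=
        (ae_restrict_iff' hDm).2 (Filter.Eventually.of_forall hΦM)
      filter_upwards [Measure.quasiMeasurePreserving_snd.ae this] with q hq
      simpa using hq
  have h1 : ∫ v in D, isotypic c χ' f v * (starRingEnd ℂ) (Φ v)
      = ∫ v in D, ∫ t, mFourier (-χ') t * f (torusRot c t v) * (starRingEnd ℂ) (Φ v) := by
    simp only [isotypic, mFourierCoeff, smul_eq_mul, integral_mul_const]
  have h2 : ∀ t, ∫ v in D, mFourier (-χ') t * f (torusRot c t v) * (starRingEnd ℂ) (Φ v)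
      = mFourier (χ - χ') t * ∫ v in D, f v * (starRingEnd ℂ) (Φ v) := by
    intro t
    rw [← (measurePreserving_torusRot_restrict hDm hD t).integral_comp
      (measurableEmbedding_torusRot c t) (fun v => f v * (starRingEnd ℂ) (Φ v)),
      ← integral_const_mul]
    refine setIntegral_congr_fun hDm fun v hv => ?_
    have hu : mFourier χ t * mFourier (-χ) t = 1 := by
      rw [← mFourier_add, add_neg_cancel, mFourier_zero, ContinuousMap.one_apply]
    simp only [hΦe t v hv, map_mul, ← mFourier_neg]
    rw [sub_eq_add_neg, mFourier_add]
    linear_combination (-(mFourier (-χ') t * f (torusRot c t v) * (starRingEnd ℂ) (Φ v))) * hu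
  rw [h1, ← integral_integral_swap hG]
  simp only [h2, integral_mul_const, integral_mFourier, sub_eq_zero, eq_comm (a := χ)]
  split_ifs <;> simp

omit [Fintype κ] in
theorem IsEquivariant.isotypic_eq {c : κ → ι} {D : Set (κ → ℂ)} {Φ : (κ → ℂ) → ℂ} {χ : ι → ℤ}
    (hΦ : IsEquivariant c χ Φ D) {v : κ → ℂ} (hv : v ∈ D) : isotypic c χ Φ v = Φ v := by
  have : ∀ t, mFourier (-χ) t * (mFourier χ t * Φ v) = Φ v := by
    intro t
    rw [← mul_assoc, ← mFourier_add, neg_add_cancel, mFourier_zero, ContinuousMap.one_apply,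
      one_mul]
  simp [isotypic, mFourierCoeff, hΦ _ v hv, this]

theorem Bornology.IsBounded.exists_norm_le_of_continuous {D : Set (κ → ℂ)}
    (hDb : Bornology.IsBounded D) {Φ : (κ → ℂ) → ℂ} (hΦ : Continuous Φ) :
    ∃ M, ∀ v ∈ D, ‖Φ v‖ ≤ M := by
  obtain ⟨M, hM⟩ := hDb.isCompact_closure.exists_bound_of_continuousOn hΦ.continuousOn
  exact ⟨M, fun v hv => hM v (subset_closure hv)⟩

theorem integrableOn_of_continuous_of_isBounded {D : Set (κ → ℂ)}
    (hDb : Bornology.IsBounded D) {Φ : (κ → ℂ) → ℂ} (hΦ : Continuous Φ) : IntegrableOn Φ D :=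
  (hΦ.continuousOn.integrableOn_compact hDb.isCompact_closure).mono_set subset_closure

/-- The `L²` norm of an isotypic component spanned by finitely many orthonormal functions. -/
theorem lintegral_enorm_sq_isotypic_eq_sum {I : Type*} [Fintype I] [DecidableEq I] {c : κ → ι}
    {D : Set (κ → ℂ)} {f : (κ → ℂ) → ℂ} {χ : ι → ℤ} {Φ : I → (κ → ℂ) → ℂ} {d : I → ℂ}
    (hDm : MeasurableSet D) (hDb : Bornology.IsBounded D) (hD : IsTorusInvariant c D)
    (hf : IntegrableOn f D) (hΦ : ∀ i, Continuous (Φ i)) (hΦe : ∀ i, IsEquivariant c χ (Φ i) D)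
    (hΦo : ∀ i i', ∫ v in D, Φ i v * (starRingEnd ℂ) (Φ i' v) = if i = i' then 1 else 0)
    (hfd : ∀ v ∈ D, isotypic c χ f v = ∑ i, d i * Φ i v) :
    ∫⁻ v in D, ‖isotypic c χ f v‖ₑ ^ 2
      = ∑ i, ENNReal.ofReal (‖∫ v in D, f v * (starRingEnd ℂ) (Φ i v)‖ ^ 2) := by
  have hpair : ∀ i, ∫ v in D, f v * (starRingEnd ℂ) (Φ i v) = d i := by
    intro i
    obtain ⟨M, hM⟩ := hDb.exists_norm_le_of_continuous (hΦ i)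
    have h := integral_isotypic_mul_conj hDm hD hf (hΦ i).aestronglyMeasurable (hΦe i) hM χ
    rw [if_pos rfl] at h
    rw [← h]
    have h2 : ∫ v in D, isotypic c χ f v * (starRingEnd ℂ) (Φ i v)
        = ∫ v in D, ∑ i', d i' * (Φ i' v * (starRingEnd ℂ) (Φ i v)) := by
      refine setIntegral_congr_fun hDm fun v hv => ?_
      simp only [hfd v hv, Finset.sum_mul, mul_assoc]
    rw [h2, integral_finsetSum]
    · simp only [integral_const_mul, hΦo]
      simp
    · intro i' _
      exact (integrableOn_of_continuous_of_isBounded hDb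
        ((hΦ i').mul (continuous_conj.comp (hΦ i)))).const_mul _
  let g : (κ → ℂ) → ℂ := fun v => ∑ i, d i * Φ i v
  have hg : Continuous g := continuous_finsetSum _ fun i _ => (hΦ i).const_mul _
  have hsq : ∀ z : ℂ, ‖z‖ₑ ^ 2 = ENNReal.ofReal (‖z‖ ^ 2) := fun z => by
    rw [ENNReal.ofReal_pow (norm_nonneg z), ofReal_norm]
  have hgi : Integrable (fun v => ‖g v‖ ^ 2) (volume.restrict D) := by
    have := (integrableOn_of_continuous_of_isBounded hDb
      (hg.mul (continuous_conj.comp hg))).re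
    refine this.congr (Filter.Eventually.of_forall fun v => ?_)
    simp [Complex.mul_conj, ← Complex.normSq_eq_norm_sq]
  have hnorm : ((∫ v in D, ‖g v‖ ^ 2 : ℝ) : ℂ) = ((∑ i, ‖d i‖ ^ 2 : ℝ) : ℂ) := by
    rw [← integral_complex_ofReal]
    have h1 : ∀ v, ((‖g v‖ ^ 2 : ℝ) : ℂ)
        = ∑ i, ∑ i', d i * (starRingEnd ℂ) (d i') * (Φ i v * (starRingEnd ℂ) (Φ i' v)) := by
      intro v
      rw [← Complex.normSq_eq_norm_sq, ← Complex.mul_conj]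
      simp only [g, map_sum, map_mul, Finset.sum_mul_sum]
      refine Finset.sum_congr rfl fun i _ => Finset.sum_congr rfl fun i' _ => ?_
      ring
    have hint : ∀ i i', Integrable (fun v => d i * (starRingEnd ℂ) (d i') *
        (Φ i v * (starRingEnd ℂ) (Φ i' v))) (volume.restrict D) := fun i i' =>
      (integrableOn_of_continuous_of_isBounded hDb
        ((hΦ i).mul (continuous_conj.comp (hΦ i')))).const_mul _
    simp only [h1]
    rw [integral_finsetSum _ fun i _ => integrable_finsetSum _ fun i' _ => hint i i']
    push_cast
    refine Finset.sum_congr rfl fun i _ => ?_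
    rw [integral_finsetSum _ fun i' _ => hint i i']
    simp only [integral_const_mul, hΦo]
    simp [Complex.mul_conj, Complex.normSq_eq_norm_sq]
  have h3 : ∫⁻ v in D, ‖isotypic c χ f v‖ₑ ^ 2 = ∫⁻ v in D, ENNReal.ofReal (‖g v‖ ^ 2) := by
    refine setLIntegral_congr_fun hDm fun v hv => ?_
    simp only [hfd v hv, hsq, g]
  rw [h3, ← ofReal_integral_eq_lintegral_ofReal hgi (Filter.Eventually.of_forall fun v => by positivity),
    Complex.ofReal_injective hnorm, ENNReal.ofReal_sum_of_nonneg fun i _ => by positivity]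
  simp only [hpair]

/-- Equivariant functions of different weights are orthogonal. -/
theorem IsEquivariant.integral_mul_conj_eq_zero {c : κ → ι} {D : Set (κ → ℂ)} {Φ Ψ : (κ → ℂ) → ℂ}
    {χ ψ : ι → ℤ} (hDm : MeasurableSet D) (hDb : Bornology.IsBounded D) (hD : IsTorusInvariant c D)
    (hΦ : Continuous Φ) (hΨ : Continuous Ψ) (hΦe : IsEquivariant c χ Φ D)
    (hΨe : IsEquivariant c ψ Ψ D) (h : χ ≠ ψ) :
    ∫ v in D, Φ v * (starRingEnd ℂ) (Ψ v) = 0 := by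
  obtain ⟨M, hM⟩ := hDb.exists_norm_le_of_continuous hΨ
  have h1 := integral_isotypic_mul_conj hDm hD (integrableOn_of_continuous_of_isBounded hDb hΦ)
    hΨ.aestronglyMeasurable hΨe hM χ
  rw [if_neg h] at h1
  rw [← h1]
  exact setIntegral_congr_fun hDm fun v hv => by simp only [hΦe.isotypic_eq hv]

/-- Parseval's identity for a system which spans every isotypic component of `f`. -/
theorem integral_norm_sq_eq_tsum_of_isotypic {J : Type*} {I : J → Type*} [∀ j, Fintype (I j)]
    [∀ j, DecidableEq (I j)] {c : κ → ι} {D : Set (κ → ℂ)} {f : (κ → ℂ) → ℂ} {w : J → ι → ℤ}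
    {Φ : ∀ j, I j → (κ → ℂ) → ℂ}
    (hDo : IsOpen D) (hDb : Bornology.IsBounded D) (hD : IsTorusInvariant c D)
    (hf : IsLineHol f D) (hfi : IntegrableOn f D) (hw : Function.Injective w)
    (hΦ : ∀ j i, Continuous (Φ j i)) (hΦe : ∀ j i, IsEquivariant c (w j) (Φ j i) D)
    (hΦo : ∀ j i i', ∫ v in D, Φ j i v * (starRingEnd ℂ) (Φ j i' v) = if i = i' then 1 else 0)
    (hspan : ∀ j, ∃ d : I j → ℂ, ∀ v ∈ D, isotypic c (w j) f v = ∑ i, d i * Φ j i v)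
    (hzero : ∀ χ, χ ∉ Set.range w → ∀ v ∈ D, isotypic c χ f v = 0) :
    ∫ v in D, ‖f v‖ ^ 2
      = ∑' q : Σ j, I j, ‖∫ v in D, f v * (starRingEnd ℂ) (Φ q.1 q.2 v)‖ ^ 2 := by
  have hDm := hDo.measurableSet
  have hsq : ∀ z : ℂ, ENNReal.ofReal (‖z‖ ^ 2) = ‖z‖ₑ ^ 2 := fun z => by
    rw [ENNReal.ofReal_pow (norm_nonneg z), ofReal_norm]
  have hsupp : Function.support (fun χ : ι → ℤ => ∫⁻ v in D, ‖isotypic c χ f v‖ₑ ^ 2)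
      ⊆ Set.range w := by
    intro χ hχ
    by_contra hn
    refine hχ ?_
    have : ∫⁻ v in D, ‖isotypic c χ f v‖ₑ ^ 2 = ∫⁻ v in D, 0 :=
      setLIntegral_congr_fun hDm fun v hv => by simp [hzero χ hn v hv]
    simpa using this
  have key : ∫⁻ v in D, ‖f v‖ₑ ^ 2 = ∑' q : Σ j, I j,
      ENNReal.ofReal (‖∫ v in D, f v * (starRingEnd ℂ) (Φ q.1 q.2 v)‖ ^ 2) := by
    rw [lintegral_enorm_sq_eq_tsum_isotypic hf hDo hD, ← hw.tsum_eq hsupp,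
      ENNReal.tsum_sigma fun j i =>
        ENNReal.ofReal (‖∫ v in D, f v * (starRingEnd ℂ) (Φ j i v)‖ ^ 2)]
    refine tsum_congr fun j => ?_
    obtain ⟨d, hd⟩ := hspan j
    rw [tsum_fintype]
    exact lintegral_enorm_sq_isotypic_eq_sum hDm hDb hD hfi (hΦ j) (hΦe j) (hΦo j) hd
  have hmeas : AEStronglyMeasurable (fun v => ‖f v‖ ^ 2) (volume.restrict D) :=
    (hf.1.norm.pow 2).aestronglyMeasurable hDm
  rw [integral_eq_lintegral_of_nonneg_ae (Filter.Eventually.of_forall fun v => by positivity)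
    hmeas]
  simp only [hsq] at key ⊢
  rw [key, ENNReal.tsum_toReal_eq fun q => by simp]
  simp

variable {m n : ℕ}

/-- The torus acts on `ℂ^m × ℂ^n` by rotating each of the first `m` coordinates separately and the
last `n` coordinates simultaneously. -/
def semiReinhardtColor (m n : ℕ) : Fin m ⊕ Fin n → Option (Fin m) :=
  Sum.elim some fun _ => none

/-- The weight of `w^j Q(z)`, where `Q` is homogeneous of degree `k`. -/
def semiReinhardtWeight (j : Fin m → ℕ) (k : ℕ) : Option (Fin m) → ℤ :=
  fun o => o.elim (k : ℤ) fun l => (j l : ℤ)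

theorem semiReinhardtWeight_injective :
    Function.Injective fun q : Σ _ : Fin m → ℕ, ℕ => semiReinhardtWeight q.1 q.2 := by
  rintro ⟨j, k⟩ ⟨j', k'⟩ h
  have hk : k = k' := by simpa [semiReinhardtWeight] using congrFun h none
  have hj : j = j' := funext fun l => by simpa [semiReinhardtWeight] using congrFun h (some l)
  rw [hk, hj]

theorem pushWeight_semiReinhardtColor (b : Fin m ⊕ Fin n → ℕ) :
    pushWeight (semiReinhardtColor m n) (fun x => (b x : ℤ))
      = semiReinhardtWeight (fun l => b (.inl l)) (∑ a, b (.inr a)) := by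
  ext o
  rw [pushWeight, Finset.sum_filter, Fintype.sum_sum_type]
  cases o <;> simp [semiReinhardtColor, semiReinhardtWeight]

/-- The function `w^j Q(z)`. -/
noncomputable def monomialMul (j : Fin m → ℕ) (Q : MvPolynomial (Fin n) ℂ)
    (v : Fin m ⊕ Fin n → ℂ) : ℂ :=
  (∏ l, v (.inl l) ^ j l) * MvPolynomial.eval (fun a => v (.inr a)) Q

theorem continuous_monomialMul (j : Fin m → ℕ) (Q : MvPolynomial (Fin n) ℂ) :
    Continuous (monomialMul j Q) :=
  (by fun_prop : Continuous fun v : Fin m ⊕ Fin n → ℂ => ∏ l, v (.inl l) ^ j l).mul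
    (Q.continuous_eval.comp (by fun_prop))

theorem isEquivariant_monomialMul (j : Fin m → ℕ) {k : ℕ} {Q : MvPolynomial (Fin n) ℂ}
    (hQ : Q.IsHomogeneous k) (D : Set (Fin m ⊕ Fin n → ℂ)) :
    IsEquivariant (semiReinhardtColor m n) (semiReinhardtWeight j k) (monomialMul j Q) D := by
  have heq : monomialMul j Q = fun v => ∑ d ∈ Q.support,
      Q.coeff d * ∏ x, v x ^ (Sum.elim j d : Fin m ⊕ Fin n → ℕ) x := by
    ext v
    simp only [monomialMul, MvPolynomial.eval_eq', Finset.mul_sum, Fintype.prod_sum_type,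
      Sum.elim_inl, Sum.elim_inr]
    exact Finset.sum_congr rfl fun d _ => mul_left_comm _ _ _
  intro t v hv
  simp only [heq, Finset.mul_sum]
  refine Finset.sum_congr rfl fun d hd => ?_
  have h := isEquivariant_monomial (semiReinhardtColor m n) (Sum.elim j d) D t v hv
  simp only [pushWeight_semiReinhardtColor, Sum.elim_inl, Sum.elim_inr] at h
  have hk : ∑ a, d a = k := by
    rw [hQ.degree_eq_sum_deg_support hd, ← Finsupp.degree_apply, Finsupp.degree_eq_sum]
  rw [h, hk]
  exact mul_left_comm _ _ _

/-- The isotypic components of a holomorphic function on a semi-Reinhardt domain. -/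
theorem isotypic_semiReinhardtWeight_eq {D : Set (Fin m ⊕ Fin n → ℂ)} {f : (Fin m ⊕ Fin n → ℂ) → ℂ}
    (hf : IsLineHol f D) (hDo : IsOpen D) (hDc : IsPreconnected D) (hD0 : 0 ∈ D)
    (hD : IsTorusInvariant (semiReinhardtColor m n) D) (j : Fin m → ℕ) (k : ℕ) :
    ∃ Q : MvPolynomial (Fin n) ℂ, Q.IsHomogeneous k ∧ ∀ v ∈ D,
      isotypic (semiReinhardtColor m n) (semiReinhardtWeight j k) f v = monomialMul j Q v := by
  obtain ⟨C, hC⟩ := (isEquivariant_isotypic (semiReinhardtColor m n) (semiReinhardtWeight j k) f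
    D).eq_polynomial (isLineHol_isotypic hf hDo hD _) hDo hDc hD0
  have hb : ∀ b ∈ weightExponents (semiReinhardtColor m n) (semiReinhardtWeight j k),
      (fun l => b (.inl l)) = j ∧ ∑ a, b (.inr a) = k := by
    intro b hb
    rw [mem_weightExponents, pushWeight_semiReinhardtColor] at hb
    have h := Sigma.mk.inj_iff.1 (@semiReinhardtWeight_injective m ⟨_, _⟩ ⟨_, _⟩ hb)
    exact ⟨h.1, eq_of_heq h.2⟩
  refine ⟨∑ b ∈ weightExponents (semiReinhardtColor m n) (semiReinhardtWeight j k),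
    MvPolynomial.monomial (Finsupp.equivFunOnFinite.symm fun a => b (.inr a)) (C b),
    MvPolynomial.IsHomogeneous.sum _ _ _ fun b h => MvPolynomial.isHomogeneous_monomial _ ?_,
    fun v hv => ?_⟩
  · simp [Finsupp.degree_eq_sum, (hb b h).2]
  · rw [hC v hv, monomialMul, map_sum, Finset.mul_sum]
    refine Finset.sum_congr rfl fun b h => ?_
    rw [MvPolynomial.eval_monomial, Fintype.prod_sum_type, Finsupp.prod_fintype _ _ (by simp)]
    simp only [Finsupp.equivFunOnFinite_symm_apply_apply, ← (hb b h).1]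
    exact mul_left_comm _ _ _

theorem isotypic_eq_zero_of_notMem_range {D : Set (Fin m ⊕ Fin n → ℂ)}
    {f : (Fin m ⊕ Fin n → ℂ) → ℂ} (hf : IsLineHol f D) (hDo : IsOpen D) (hDc : IsPreconnected D)
    (hD0 : 0 ∈ D) (hD : IsTorusInvariant (semiReinhardtColor m n) D) {χ : Option (Fin m) → ℤ}
    (hχ : χ ∉ Set.range fun q : Σ _ : Fin m → ℕ, ℕ => semiReinhardtWeight q.1 q.2) :
    ∀ v ∈ D, isotypic (semiReinhardtColor m n) χ f v = 0 := by
  obtain ⟨C, hC⟩ := (isEquivariant_isotypic (semiReinhardtColor m n) χ f D).eq_polynomial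
    (isLineHol_isotypic hf hDo hD _) hDo hDc hD0
  intro v hv
  rw [hC v hv, Finset.sum_eq_zero]
  intro b hb
  rw [mem_weightExponents, pushWeight_semiReinhardtColor] at hb
  exact (hχ ⟨⟨_, _⟩, hb⟩).elim

/-- A semi-Reinhardt set, viewed in `ℂ^(m+n)`, is invariant under the torus action. -/
theorem isTorusInvariant_of_semiReinhardt {D : Set ((Fin m → ℂ) × (Fin n → ℂ))}
    (hD : ∀ p ∈ D, ∀ θ : Fin m → ℝ, ∀ θ₀ : ℝ,
      ((fun i => Complex.exp ((θ i : ℂ) * Complex.I) * p.1 i),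
       (fun i => Complex.exp ((θ₀ : ℂ) * Complex.I) * p.2 i)) ∈ D) :
    IsTorusInvariant (semiReinhardtColor m n)
      (MeasurableEquiv.sumPiEquivProdPi (fun _ : Fin m ⊕ Fin n => ℂ) ⁻¹' D) := by
  intro t v hv
  have hθ : ∀ y : UnitAddCircle, ∃ θ : ℝ,
      (AddCircle.toCircle y : ℂ) = Complex.exp ((θ : ℂ) * Complex.I) := by
    intro y
    induction y using QuotientAddGroup.induction_on with
    | H s => exact ⟨_, by rw [AddCircle.toCircle_apply_mk, Circle.coe_exp]⟩
  choose θ hθ using hθ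
  have h := hD _ hv (fun i => θ (t (some i))) (θ (t none))
  simp only [← hθ] at h
  exact h

theorem exists_isotypic_eq_sum_of_span {D : Set (Fin m ⊕ Fin n → ℂ)} {f : (Fin m ⊕ Fin n → ℂ) → ℂ}
    (hf : IsLineHol f D) (hDo : IsOpen D) (hDc : IsPreconnected D) (hD0 : 0 ∈ D)
    (hD : IsTorusInvariant (semiReinhardtColor m n) D) (j : Fin m → ℕ) (k : ℕ) {I : Type*}
    [Fintype I] (P : I → MvPolynomial (Fin n) ℂ)
    (hP : ∀ Q : MvPolynomial (Fin n) ℂ, Q.IsHomogeneous k →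
      Q ∈ Submodule.span ℂ (Set.range P)) :
    ∃ d : I → ℂ, ∀ v ∈ D, isotypic (semiReinhardtColor m n) (semiReinhardtWeight j k) f v
      = ∑ i, d i * monomialMul j (P i) v := by
  obtain ⟨Q, hQ, hfQ⟩ := isotypic_semiReinhardtWeight_eq hf hDo hDc hD0 hD j k
  obtain ⟨d, rfl⟩ := (Submodule.mem_span_range_iff_exists_fun ℂ).1 (hP Q hQ)
  refine ⟨d, fun v hv => ?_⟩
  simp only [hfQ v hv, monomialMul, map_sum, MvPolynomial.smul_eval, Finset.mul_sum]
  exact Finset.sum_congr rfl fun i _ => mul_left_comm _ _ _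

end Torus

/-- A square-integrable continuous function on an open set of finite measure is integrable. -/
theorem integrableOn_of_integrableOn_norm_sq {E : Type*} [NormedAddCommGroup E] [MeasurableSpace E]
    [OpensMeasurableSpace E] [SecondCountableTopology E] {μ : Measure E}
    {D : Set E} {f : E → ℂ} (hDo : IsOpen D) (hDμ : μ D ≠ ⊤) (hf : ContinuousOn f D)
    (hf2 : IntegrableOn (fun p => ‖f p‖ ^ 2) D μ) : IntegrableOn f D μ := by
  have hm := hf.aestronglyMeasurable (μ := μ) hDo.measurableSet
  refine ((integrableOn_const hDμ (C := (1 : ℝ))).add hf2).mono' hm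
    (Filter.Eventually.of_forall fun p => ?_)
  simp only [Pi.add_apply]
  nlinarith [sq_nonneg (‖f p‖ - 1), norm_nonneg (f p)]

/-- Let `D ⊂ ℂ^m × ℂ^n` be a semi-Reinhardt bounded domain.  For each multi-index
`j ∈ ℕ^m` and each `k ∈ ℕ`, let `{P^{(j)}_{k,i}}` (`1 ≤ i ≤ m_k = C(n+k-1,k)`) be a
basis of the space of homogeneous polynomials of degree `k` in `z` which is
orthonormal for the weighted inner product `(f|g)^{(j)} = ∫_D |w^j|² f(z) conj(g(z))`.
Then the family `{w^j P^{(j)}_{k,i}(z)}` is a complete orthonormal system of the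
Bergman space `A²(D)`: it is orthonormal in `L²(D)`, and Parseval's identity holds
for every square-integrable holomorphic function on `D`. -/
theorem semiReinhardt_complete_orthonormal_system (m n : ℕ)
    (D : Set ((Fin m → ℂ) × (Fin n → ℂ)))
    (hDopen : IsOpen D) (hDconn : IsConnected D) (hDbdd : Bornology.IsBounded D)
    (hD0 : (0 : (Fin m → ℂ) × (Fin n → ℂ)) ∈ D)
    (hDsR : ∀ p ∈ D, ∀ θ : Fin m → ℝ, ∀ θ₀ : ℝ,
      ((fun i => Complex.exp ((θ i : ℂ) * Complex.I) * p.1 i),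
       (fun i => Complex.exp ((θ₀ : ℂ) * Complex.I) * p.2 i)) ∈ D)
    (P : (Fin m → ℕ) → (k : ℕ) → Fin ((n + k - 1).choose k) → MvPolynomial (Fin n) ℂ)
    -- each `P j k i` is homogeneous of degree `k`
    (hPhom : ∀ j k i, (P j k i).IsHomogeneous k)
    -- for fixed `j`, `k`, the family spans the homogeneous polynomials of degree `k`
    (hPspan : ∀ j k (Q : MvPolynomial (Fin n) ℂ), Q.IsHomogeneous k →
      Q ∈ Submodule.span ℂ (Set.range (P j k)))
    -- orthonormality for the weighted inner product `(f|g)^{(j)}`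
    (hPorth : ∀ j k i i',
      ∫ p in D, ((∏ l, ‖p.1 l‖ ^ (2 * j l) : ℝ) : ℂ) *
          (MvPolynomial.eval p.2 (P j k i) *
            (starRingEnd ℂ) (MvPolynomial.eval p.2 (P j k i')))
        = if i = i' then 1 else 0) :
    -- the family `Φ_{j,k,i}(w,z) = w^j P^{(j)}_{k,i}(z)` is orthonormal in `L²(D)` ...
    (∀ q q' : Σ j : Fin m → ℕ, Σ k : ℕ, Fin ((n + k - 1).choose k),
      ∫ p in D,
          ((∏ l, p.1 l ^ q.1 l) * MvPolynomial.eval p.2 (P q.1 q.2.1 q.2.2)) *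
            (starRingEnd ℂ)
              ((∏ l, p.1 l ^ q'.1 l) * MvPolynomial.eval p.2 (P q'.1 q'.2.1 q'.2.2))
        = if q = q' then 1 else 0) ∧
    -- ... and complete: Parseval's identity holds for every `f ∈ A²(D)`
    (∀ f : (Fin m → ℂ) × (Fin n → ℂ) → ℂ,
      DifferentiableOn ℂ f D → IntegrableOn (fun p => ‖f p‖ ^ 2) D →
      ∫ p in D, ‖f p‖ ^ 2
        = ∑' q : Σ j : Fin m → ℕ, Σ k : ℕ, Fin ((n + k - 1).choose k),
            ‖∫ p in D, f p *
              (starRingEnd ℂ)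
                ((∏ l, p.1 l ^ q.1 l) * MvPolynomial.eval p.2 (P q.1 q.2.1 q.2.2))‖ ^ 2) := by
  let e := MeasurableEquiv.sumPiEquivProdPi fun _ : Fin m ⊕ Fin n => ℂ
  let L := ContinuousLinearEquiv.sumPiEquivProdPi ℂ (Fin m) (Fin n) fun _ => ℂ
  have he : MeasurePreserving e := volume_measurePreserving_sumPiEquivProdPi _
  have hint : ∀ g : (Fin m → ℂ) × (Fin n → ℂ) → ℂ,
      ∫ v in e ⁻¹' D, g (e v) = ∫ p in D, g p := fun g =>
    he.setIntegral_preimage_emb e.measurableEmbedding g D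
  have hD'o : IsOpen (e ⁻¹' D) := hDopen.preimage L.continuous
  have hD'c : IsPreconnected (e ⁻¹' D) :=
    (L.toHomeomorph.isPreconnected_preimage).2 hDconn.isPreconnected
  have hD'0 : (0 : Fin m ⊕ Fin n → ℂ) ∈ e ⁻¹' D := hD0
  have hD'b : Bornology.IsBounded (e ⁻¹' D) := by
    have := L.symm.lipschitz.isBounded_image hDbdd
    rwa [ContinuousLinearEquiv.image_symm_eq_preimage] at this
  have hD't : IsTorusInvariant (semiReinhardtColor m n) (e ⁻¹' D) :=
    isTorusInvariant_of_semiReinhardt hDsR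
  have hΦe : ∀ j k i, IsEquivariant (semiReinhardtColor m n) (semiReinhardtWeight j k)
      (monomialMul j (P j k i)) (e ⁻¹' D) := fun j k i =>
    isEquivariant_monomialMul j (hPhom j k i) _
  have hΦo : ∀ j k i i', ∫ v in e ⁻¹' D, monomialMul j (P j k i) v *
      (starRingEnd ℂ) (monomialMul j (P j k i') v) = if i = i' then 1 else 0 := by
    intro j k i i'
    rw [← hPorth j k i i', ← hint]
    refine integral_congr_ae (Filter.Eventually.of_forall fun v => ?_)
    have h1 : ((∏ l, ‖v (.inl l)‖ ^ (2 * j l) : ℝ) : ℂ)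
        = (∏ l, v (.inl l) ^ j l) * (starRingEnd ℂ) (∏ l, v (.inl l) ^ j l) := by
      rw [Complex.mul_conj, Complex.normSq_eq_norm_sq, norm_prod, ← Finset.prod_pow]
      simp only [norm_pow, ← pow_mul, mul_comm]
    change monomialMul j (P j k i) v * (starRingEnd ℂ) (monomialMul j (P j k i') v) =
      ((∏ l, ‖v (.inl l)‖ ^ (2 * j l) : ℝ) : ℂ) *
        (MvPolynomial.eval (fun a => v (.inr a)) (P j k i) *
          (starRingEnd ℂ) (MvPolynomial.eval (fun a => v (.inr a)) (P j k i')))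
    rw [h1, monomialMul, monomialMul, map_mul]
    ring
  refine ⟨?_, fun f hf hf2 => ?_⟩
  · rintro ⟨j, k, i⟩ ⟨j', k', i'⟩
    rw [← hint]
    change ∫ v in e ⁻¹' D, monomialMul j (P j k i) v *
      (starRingEnd ℂ) (monomialMul j' (P j' k' i') v) = _
    by_cases h : (⟨j, k⟩ : Σ _ : Fin m → ℕ, ℕ) = ⟨j', k'⟩
    · obtain ⟨rfl, hk⟩ := Sigma.mk.inj_iff.1 h
      obtain rfl := eq_of_heq hk
      simp [hΦo]
    · rw [(hΦe j k i).integral_mul_conj_eq_zero hD'o.measurableSet hD'b hD't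
        (continuous_monomialMul _ _) (continuous_monomialMul _ _) (hΦe j' k' i')
        (semiReinhardtWeight_injective.ne h), if_neg]
      rintro ⟨⟩
      exact h rfl
  · have hfi : IntegrableOn f D := integrableOn_of_integrableOn_norm_sq hDopen
      hDbdd.measure_lt_top.ne hf.continuousOn hf2
    have hf' : IsLineHol (f ∘ e) (e ⁻¹' D) := isLineHol_of_differentiableOn
      (hf.comp L.differentiable.differentiableOn fun _ h => h)
    have h := integral_norm_sq_eq_tsum_of_isotypic (f := f ∘ e)
      (Φ := fun q : Σ _ : Fin m → ℕ, ℕ => fun i => monomialMul q.1 (P q.1 q.2 i))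
      hD'o hD'b hD't hf' ((he.integrableOn_comp_preimage e.measurableEmbedding).2 hfi)
      semiReinhardtWeight_injective (fun q i => continuous_monomialMul _ _)
      (fun q => hΦe q.1 q.2) (fun q => hΦo q.1 q.2)
      (fun q => exists_isotypic_eq_sum_of_span hf' hD'o hD'c hD'0 hD't q.1 q.2 _ (hPspan q.1 q.2))
      (fun χ => isotypic_eq_zero_of_notMem_range hf' hD'o hD'c hD'0 hD't)
    rw [← he.setIntegral_preimage_emb e.measurableEmbedding]
    refine h.trans ?_
    rw [← (Equiv.sigmaAssoc fun (_ : Fin m → ℕ) k => Fin ((n + k - 1).choose k)).tsum_eq]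
    refine tsum_congr fun q => ?_
    rw [← hint]
    rfl
end
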